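/- Let ℓ ≥ 0 be a fixed integer and define the additive function Ω_ℓ(n) = Σ_{p^ν || n} ν^ℓ (sum over prime powers p^ν exactly dividing n). Then for every fixed integer N ≥ 1: Σ_{n ≤ x} Ω_ℓ(n) = x·log log x + C·x + x·Σ_{j=1}^{N} a_j / (log x)^j + O( x / (log x)^{N+1} ) as x → ∞, where C = γ + Σ_p ( log(1 − 1/p) + (1 − 1/p)·Σ_{ν=1}^{∞} ν^ℓ / p^ν ) (the sum over all primes, absolutely convergent) and a_j = − ∫_1^∞ (t − ⌊t⌋)·(log t)^{j−1} / t² dt. -/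

import Mathlib

set_option linter.all false
namespace Stmt9
open Complex Filter Topology

noncomputable def psi (n : ℕ) (s : ℂ) : ℂ :=
  (s - 1) * ((n : ℂ) + 1) ^ (-s) + (((n : ℂ) + 1 + 1) ^ (1 - s) - ((n : ℂ) + 1) ^ (1 - s))

lemma diff_bound (n : ℕ) (s : ℂ) (hs : 0 < s.re) (δ : ℝ) (hδ0 : 0 < δ) (hδ : δ < 1)
    (u : ℝ) (hu : u ∈ Set.Icc ((n : ℝ) + 1) (n + 1 + 1)) :
    ‖(((n : ℝ) + 1 : ℝ) : ℂ) ^ (-s) - (u : ℂ) ^ (-s)‖ ≤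
      2 * (1 + ‖s‖) ^ δ * ((n : ℝ) + 1) ^ (-(s.re + δ)) := by
  set m : ℝ := (n : ℝ) + 1 with hm
  have hm0 : 0 < m := by positivity
  have hu0 : 0 < u := lt_of_lt_of_le hm0 hu.1
  have h1 : ‖(m : ℂ) ^ (-s) - (u : ℂ) ^ (-s)‖ ≤ 2 * m ^ (-s.re) := by
    refine (norm_sub_le _ _).trans ?_
    rw [norm_cpow_eq_rpow_re_of_pos hm0, norm_cpow_eq_rpow_re_of_pos hu0, neg_re]
    have := Real.rpow_le_rpow_of_nonpos hm0 hu.1 (by linarith : -s.re ≤ 0)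
    linarith
  have h2 : ‖(m : ℂ) ^ (-s) - (u : ℂ) ^ (-s)‖ ≤ (1 + ‖s‖) * m ^ (-(s.re + 1)) := by
    have key := (convex_Icc m (m+1)).norm_image_sub_le_of_norm_hasDerivWithin_le
      (f := fun x : ℝ => (x : ℂ) ^ (-s)) (f' := fun x : ℝ => (-s) * (x : ℂ) ^ (-s - 1))
      (C := (1 + ‖s‖) * m ^ (-(s.re + 1))) ?_ ?_ hu (Set.left_mem_Icc.2 (by linarith))
    · refine key.trans ?_
      have : ‖m - u‖ ≤ 1 := by
        rw [Real.norm_eq_abs, abs_le]; constructor <;> linarith [hu.1, hu.2]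
      exact mul_le_of_le_one_right (by positivity) this
    · intro x hx
      have hx0 : 0 < x := lt_of_lt_of_le hm0 hx.1
      have := (hasDerivAt_ofReal_cpow_const (x := x) hx0.ne' (r := -s) (by
        intro h; rw [neg_eq_zero] at h; rw [h] at hs; simp at hs))
      exact this.hasDerivWithinAt
    · intro x hx
      have hx0 : 0 < x := lt_of_lt_of_le hm0 hx.1
      rw [norm_mul, norm_cpow_eq_rpow_re_of_pos hx0, norm_neg]
      have := Real.rpow_le_rpow_of_nonpos hm0 hx.1 (by linarith : -(s.re+1) ≤ 0)
      have e : (-s - 1).re = -(s.re + 1) := by simp; ring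
      rw [e]
      gcongr
      linarith
  set X := ‖(m : ℂ) ^ (-s) - (u : ℂ) ^ (-s)‖
  have hX : 0 ≤ X := norm_nonneg _
  calc X = X ^ (1 - δ) * X ^ δ := by
        rw [← Real.rpow_add_of_nonneg hX (by linarith) hδ0.le]; simp
    _ ≤ (2 * m ^ (-s.re)) ^ (1 - δ) * ((1 + ‖s‖) * m ^ (-(s.re + 1))) ^ δ := by
        gcongr
    _ = 2 ^ (1 - δ) * (1 + ‖s‖) ^ δ * m ^ (-(s.re + δ)) := by
        rw [Real.mul_rpow (by norm_num) (by positivity), Real.mul_rpow (by positivity) (by positivity),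
          ← Real.rpow_mul hm0.le, ← Real.rpow_mul hm0.le]
        have : -(s.re + δ) = -s.re * (1 - δ) + -(s.re + 1) * δ := by ring
        rw [this, Real.rpow_add hm0]; ring
    _ ≤ _ := by
        have : (2 : ℝ) ^ (1 - δ) ≤ 2 ^ (1 : ℝ) := by
          apply Real.rpow_le_rpow_of_exponent_le <;> linarith
        rw [Real.rpow_one] at this
        gcongr

lemma psi_bound (n : ℕ) (s : ℂ) (hs : 0 < s.re) (δ : ℝ) (hδ0 : 0 < δ) (hδ : δ < 1) :
    ‖psi n s‖ ≤ ‖s - 1‖ * (2 * (1 + ‖s‖) ^ δ * ((n : ℝ) + 1) ^ (-(s.re + δ))) := by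
  by_cases h1 : s = 1
  · subst h1; simp [psi]
  have hs1 : s - 1 ≠ 0 := sub_ne_zero.2 h1
  have hm0 : (0:ℝ) < (n:ℝ) + 1 := by positivity
  have hint : ∫ u in ((n:ℝ)+1)..((n:ℝ)+1+1), ((u:ℂ) ^ (-s)) =
      (((((n:ℝ)+1+1 : ℝ)) : ℂ) ^ (-s + 1) - (((n:ℝ)+1 : ℝ) : ℂ) ^ (-s+1)) / (-s+1) := by
    apply integral_cpow
    right
    refine ⟨?_, ?_⟩
    · intro h; apply h1; rw [neg_inj] at h; exact h
    · rw [Set.uIcc_of_le (by linarith)]; intro h; linarith [h.1]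
  have hii : IntervalIntegrable (fun u : ℝ => (u:ℂ) ^ (-s)) MeasureTheory.volume ((n:ℝ)+1) ((n:ℝ)+1+1) := by
    apply intervalIntegral.intervalIntegrable_cpow
    right
    rw [Set.uIcc_of_le (by linarith)]; intro h; linarith [h.1]
  have e : psi n s = (s - 1) * ∫ u in ((n:ℝ)+1)..((n:ℝ)+1+1), ((((n : ℝ) + 1 : ℝ) : ℂ) ^ (-s) - (u:ℂ) ^ (-s)) := by
    rw [intervalIntegral.integral_sub (by simp) hii, hint, intervalIntegral.integral_const]
    unfold psi
    have : -s + 1 ≠ 0 := by intro h; apply hs1; linear_combination -h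
    have e2 : (1 - s) = -s + 1 := by ring
    rw [e2]
    push_cast
    field_simp
    simp
    ring
  rw [e, norm_mul]
  gcongr
  have := intervalIntegral.norm_integral_le_of_norm_le_const (a := (n:ℝ)+1) (b := (n:ℝ)+1+1)
    (f := fun u : ℝ => ((((n : ℝ) + 1 : ℝ) : ℂ) ^ (-s) - (u:ℂ) ^ (-s)))
    (C := 2 * (1 + ‖s‖) ^ δ * ((n : ℝ) + 1) ^ (-(s.re + δ))) ?_
  · simpa using this
  · intro u hu
    rw [Set.uIoc_of_le (by linarith)] at hu
    exact diff_bound n s hs δ hδ0 hδ u ⟨hu.1.le, hu.2⟩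

lemma summable_aux (a : ℝ) (ha : 1 < a) : Summable (fun n : ℕ => ((n:ℝ)+1) ^ (-a)) := by
  have := (summable_nat_add_iff 1).2 (Real.summable_nat_rpow.2 (by linarith : -a < -1))
  simpa using this

lemma psi_summable (s : ℂ) (hs : 3/4 < s.re) : Summable (fun n => psi n s) := by
  refine Summable.of_norm_bounded ?_ (fun n => psi_bound n s (by linarith) (1/2) (by norm_num) (by norm_num))
  exact ((summable_aux _ (by linarith)).mul_left _).mul_left _

lemma psi_diff (n : ℕ) : Differentiable ℂ (psi n) := by
  unfold psi
  have h1 : (n:ℂ) + 1 ≠ 0 := by exact_mod_cast (Nat.succ_ne_zero n)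
  have h2 : (n:ℂ) + 1 + 1 ≠ 0 := by exact_mod_cast (Nat.succ_ne_zero (n+1))
  intro s
  have : ∀ c : ℂ, c ≠ 0 → ∀ f : ℂ → ℂ, DifferentiableAt ℂ f s → DifferentiableAt ℂ (fun z => c ^ (f z)) s :=
    fun c hc f hf => hf.const_cpow (Or.inl hc)
  refine DifferentiableAt.add (DifferentiableAt.mul (by fun_prop) (this _ h1 _ (by fun_prop))) 
    (DifferentiableAt.sub (this _ h2 _ (by fun_prop)) (this _ h1 _ (by fun_prop)))

lemma zeta1_eq_of_one_lt (s : ℂ) (hs : 1 < s.re) : riemannZeta₁ s = 1 + ∑' n, psi n s := by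
  have h1 : s ≠ 1 := by rintro rfl; simp at hs
  have hs1 : s - 1 ≠ 0 := sub_ne_zero.2 h1
  have hz := zeta_eq_tsum_one_div_nat_add_one_cpow hs
  have hsum : Summable (fun n : ℕ => 1 / ((n:ℂ) + 1) ^ s) := by
    have := (summable_nat_add_iff 1).2 (Complex.summable_one_div_nat_cpow.2 hs)
    simpa using this
  have t1 := (psi_summable s (by linarith)).hasSum.tendsto_sum_nat
  have t2 := hsum.hasSum.tendsto_sum_nat
  rw [← hz] at t2
  have part : ∀ N, ∑ n ∈ Finset.range N, psi n s =
      (s - 1) * ∑ n ∈ Finset.range N, 1 / ((n:ℂ) + 1) ^ s + (((N:ℂ) + 1) ^ (1 - s) - 1) := by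
    intro N
    induction N with
    | zero => simp
    | succ N ih =>
      rw [Finset.sum_range_succ, ih, Finset.sum_range_succ, psi, Complex.cpow_neg]
      push_cast
      ring
  have t3 : Tendsto (fun N : ℕ => ((N:ℂ) + 1) ^ (1 - s)) atTop (𝓝 0) := by
    rw [tendsto_zero_iff_norm_tendsto_zero]
    have : ∀ N : ℕ, ‖((N:ℂ) + 1) ^ (1 - s)‖ = ((N:ℝ)+1) ^ (-(s.re - 1)) := by
      intro N
      have := norm_cpow_eq_rpow_re_of_pos (by positivity : (0:ℝ) < (N:ℝ)+1) (1 - s)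
      push_cast at this
      rw [this]; simp
    simp_rw [this]
    exact (tendsto_rpow_neg_atTop (by linarith)).comp
      (tendsto_atTop_add_const_right _ _ tendsto_natCast_atTop_atTop)
  have t4 := (t2.const_mul (s-1)).add (t3.sub_const 1)
  simp_rw [← part] at t4
  have := tendsto_nhds_unique t1 t4
  rw [this, riemannZeta₁, riemannZeta₀, if_neg h1]
  field_simp
  ring

lemma zeta1_eq (s : ℂ) (hs : 3/4 < s.re) : riemannZeta₁ s = 1 + ∑' n, psi n s := by
  set R : ℝ := 3 + ‖s‖
  set V : Set ℂ := {z | 3/4 < z.re} ∩ Metric.ball 0 R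
  have hVo : IsOpen V := (isOpen_lt continuous_const continuous_re).inter Metric.isOpen_ball
  have hVc : Convex ℝ V := (convex_halfSpace_re_gt _).inter (convex_ball _ _)
  have hd : DifferentiableOn ℂ (fun z => ∑' n, psi n z) V := by
    refine Complex.differentiableOn_tsum_of_summable_norm (u := fun n : ℕ => (R + 1) * (2 * (1 + R) ^ (1/2:ℝ) * ((n : ℝ) + 1) ^ (-(3/4 + 1/2 : ℝ)))) ?_ (fun n => (psi_diff n).differentiableOn) hVo ?_
    · exact ((summable_aux _ (by norm_num)).mul_left _).mul_left _
    · intro n z hz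
      have hz1 : 3/4 < z.re := hz.1
      have hz2 : ‖z‖ < R := by simpa using hz.2
      refine (psi_bound n z (by linarith) (1/2) (by norm_num) (by norm_num)).trans ?_
      have : ‖z - 1‖ ≤ R + 1 := by
        refine (norm_sub_le _ _).trans ?_
        simp; linarith
      have h3 : ((n : ℝ) + 1) ^ (-(z.re + 1/2)) ≤ ((n : ℝ) + 1) ^ (-(3/4 + 1/2 : ℝ)) := by
        apply Real.rpow_le_rpow_of_exponent_le
        · linarith [Nat.cast_nonneg (α := ℝ) n]
        · linarith
      gcongr
  have h2 : (2:ℂ) ∈ V := by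
    refine ⟨by simp; norm_num, ?_⟩
    simp [R]
    linarith [norm_nonneg s]
  have := AnalyticOnNhd.eqOn_of_preconnected_of_eventuallyEq
    (differentiable_riemannZeta₁.differentiableOn.analyticOnNhd hVo)
    (((differentiableOn_const (1:ℂ)).add hd).analyticOnNhd hVo) hVc.isPreconnected h2 ?_
  · exact this ⟨hs, by simp [R]⟩
  · have : {z : ℂ | 1 < z.re} ∈ 𝓝 (2:ℂ) := (isOpen_lt continuous_const continuous_re).mem_nhds (by simp)
    filter_upwards [this] with z hz
    exact zeta1_eq_of_one_lt z hz

/-- growth bound slightly to the left of the 1-line -/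
lemma zeta_growth (ε : ℝ) (h0 : 0 < ε) (h1 : ε < 1/4) : ∃ C : ℝ, 0 < C ∧ ∀ s : ℂ, 1 - ε ≤ s.re →
    s.re ≤ 4 → 1 ≤ |s.im| → ‖riemannZeta s‖ ≤ C * |s.im| ^ (2 * ε) := by
  set S := ∑' n : ℕ, ((n:ℝ)+1) ^ (-(1+ε))
  have hS : 0 ≤ S := tsum_nonneg (fun n => by positivity)
  refine ⟨1 + 2 * 6 ^ (2*ε) * S, by positivity, fun s hs1 hs2 hs3 => ?_⟩
  have him : (1:ℝ) ≤ |s.im| ^ (2*ε) := Real.one_le_rpow hs3 (by linarith)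
  have hne : s ≠ 1 := by rintro rfl; simp at hs3; linarith
  have hs1' : s - 1 ≠ 0 := sub_ne_zero.2 hne
  have hn1 : 1 ≤ ‖s - 1‖ := by
    refine hs3.trans ?_
    simpa using Complex.abs_im_le_norm (s - 1)
  have hn2 : 1 + ‖s‖ ≤ 6 * |s.im| := by
    have := Complex.norm_le_abs_re_add_abs_im s
    have : |s.re| ≤ 4 := by rw [abs_le]; constructor <;> linarith
    linarith
  rw [riemannZeta_eq_inv_sub_mul hne, zeta1_eq s (by linarith)]
  have hb : ‖∑' n, psi n s‖ ≤ ‖s - 1‖ * (2 * (1 + ‖s‖) ^ (2*ε) * S) := by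
    have hh := (summable_aux (1+ε) (by linarith)).hasSum.mul_left (‖s - 1‖ * (2 * (1 + ‖s‖) ^ (2*ε)))
    refine (tsum_of_norm_bounded hh ?_).trans (le_of_eq (by ring))
    intro n
    refine (psi_bound n s (by linarith) (2*ε) (by linarith) (by linarith)).trans ?_
    rw [← mul_assoc]
    gcongr ?_ * ?_
    apply Real.rpow_le_rpow_of_exponent_le
    · linarith [Nat.cast_nonneg (α := ℝ) n]
    · linarith
  rw [norm_mul, norm_inv]
  calc ‖s - 1‖⁻¹ * ‖1 + ∑' n, psi n s‖ ≤ ‖s-1‖⁻¹ * (1 + ‖s - 1‖ * (2 * (1 + ‖s‖) ^ (2*ε) * S)) := by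
        gcongr
        refine (norm_add_le _ _).trans ?_
        simpa using hb
    _ = ‖s-1‖⁻¹ + 2 * (1 + ‖s‖) ^ (2*ε) * S := by
        have : ‖s-1‖ ≠ 0 := by linarith
        field_simp
    _ ≤ 1 + 2 * (6 * |s.im|) ^ (2*ε) * S := by
        gcongr
        exact inv_le_one_of_one_le₀ hn1
    _ = 1 + 2 * 6 ^ (2*ε) * S * |s.im| ^ (2*ε) := by
        rw [Real.mul_rpow (by norm_num) (by positivity)]; ring
    _ ≤ _ := by
        nlinarith
end Stmt9

set_option linter.all false
namespace Stmt9
open Complex Filter Topology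

def Gr (f : ℂ → ℂ) : Prop := ∀ ε : ℝ, 0 < ε → ∃ C : ℝ, 0 < C ∧ ∀ s : ℂ, 1 < s.re → s.re ≤ 2 →
  2 ≤ |s.im| → ‖f s‖ ≤ C * |s.im| ^ ε

lemma Gr.add {f g : ℂ → ℂ} (hf : Gr f) (hg : Gr g) : Gr (fun s => f s + g s) := by
  intro ε hε
  obtain ⟨C, hC, h1⟩ := hf ε hε
  obtain ⟨D, hD, h2⟩ := hg ε hε
  refine ⟨C + D, by positivity, fun s a b c => (norm_add_le _ _).trans ?_⟩
  have := h1 s a b c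
  have := h2 s a b c
  linarith

lemma Gr.mul {f g : ℂ → ℂ} (hf : Gr f) (hg : Gr g) : Gr (fun s => f s * g s) := by
  intro ε hε
  obtain ⟨C, hC, h1⟩ := hf (ε/2) (by linarith)
  obtain ⟨D, hD, h2⟩ := hg (ε/2) (by linarith)
  refine ⟨C * D, by positivity, fun s a b c => ?_⟩
  rw [norm_mul]
  have e : |s.im| ^ ε = |s.im| ^ (ε/2) * |s.im| ^ (ε/2) := by
    rw [← Real.rpow_add (by linarith)]; ring_nf
  calc _ ≤ (C * |s.im| ^ (ε/2)) * (D * |s.im| ^ (ε/2)) :=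
        mul_le_mul (h1 s a b c) (h2 s a b c) (norm_nonneg _) (by positivity)
    _ = _ := by rw [e]; ring

lemma Gr.neg {f : ℂ → ℂ} (hf : Gr f) : Gr (fun s => - f s) := by
  intro ε hε
  simpa using hf ε hε

lemma Gr_zetaD (j : ℕ) : Gr (iteratedDeriv j riemannZeta) := by
  intro ε hε
  set e := min (ε/2) (1/8) with he
  have he0 : 0 < e := by rw [he]; positivity
  have he1 : e ≤ 1/8 := min_le_right _ _
  have he2 : 2 * e ≤ ε := by linarith [min_le_left (ε/2) (1/8)]
  obtain ⟨C, hC, h⟩ := zeta_growth e he0 (by linarith)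
  refine ⟨j.factorial * (C * 2 ^ (2*e)) / e ^ j, by positivity, fun s h1 h2 h3 => ?_⟩
  have him : ∀ z ∈ Metric.closedBall s e, |s.re - z.re| ≤ 1/8 ∧ |s.re - z.re| ≤ e ∧ |s.im - z.im| ≤ 1/8 := by
    intro z hz
    rw [Metric.mem_closedBall, dist_comm, dist_eq_norm] at hz
    have := abs_re_le_norm (s - z)
    have := abs_im_le_norm (s - z)
    simp only [sub_re, sub_im] at *
    refine ⟨by linarith, by linarith, by linarith⟩
  have key := norm_iteratedDeriv_le_of_forall_mem_sphere_norm_le (F := ℂ) (n := j) (c := s) (R := e)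
    (C := C * (2 * |s.im|) ^ (2*e)) (f := riemannZeta) he0 ?_ ?_
  · refine key.trans ?_
    rw [Real.mul_rpow (by norm_num) (by positivity)]
    have : |s.im| ^ (2*e) ≤ |s.im| ^ ε := Real.rpow_le_rpow_of_exponent_le (by linarith) he2
    calc _ = j.factorial * (C * 2 ^ (2*e)) / e ^ j * |s.im| ^ (2*e) := by ring
      _ ≤ _ := by gcongr
  · refine DifferentiableOn.diffContOnCl (s := Metric.ball s e) ?_
    intro z hz
    rw [closure_ball _ he0.ne'] at hz
    refine (differentiableAt_riemannZeta ?_).differentiableWithinAt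
    rintro rfl
    have := (him _ hz).2.2
    simp at this
    linarith
  · intro z hz
    have hz' := him z (Metric.sphere_subset_closedBall hz)
    have h4 : |z.im| ≤ |s.im| + |s.im - z.im| := by
      have := abs_sub_abs_le_abs_sub z.im s.im
      rw [abs_sub_comm] at this; linarith
    have h5 : |s.im| ≤ |z.im| + |s.im - z.im| := by
      have := abs_sub_abs_le_abs_sub s.im z.im
      linarith
    have h6 := abs_le.1 hz'.1
    have h7 := abs_le.1 hz'.2.1
    refine (h z (by linarith) (by linarith) (by linarith)).trans ?_
    have : |z.im| ≤ 2 * |s.im| := by linarith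
    gcongr

lemma zeta_near : ∃ K : ℝ, 0 < K ∧ ∀ x : ℝ, 0 < x → x ≤ 1 → ‖riemannZeta (1 + x)‖ ≤ K / x := by
  have hc : ContinuousOn (fun x : ℝ => riemannZeta₁ (1 + x)) (Set.Icc 0 1) :=
    (differentiable_riemannZeta₁.continuous.comp (by fun_prop)).continuousOn
  obtain ⟨K, hK⟩ := isCompact_Icc.exists_bound_of_continuousOn hc
  refine ⟨|K| + 1, by positivity, fun x hx hx1 => ?_⟩
  have hne : (1 + (x:ℂ)) ≠ 1 := by simpa using hx.ne'
  rw [riemannZeta_eq_inv_sub_mul hne, norm_mul]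
  have := hK x ⟨hx.le, hx1⟩
  have e : ‖(1 + (x:ℂ) - 1)⁻¹‖ = x⁻¹ := by simp [abs_of_pos hx]
  rw [e, div_eq_inv_mul]
  gcongr
  linarith [le_abs_self K]

lemma three_four_one (x : ℝ) (hx : 0 < x) (y : ℝ) :
    1 ≤ ‖riemannZeta (1 + x)‖ ^ 3 * ‖riemannZeta (1 + x + I * y)‖ ^ 4 * ‖riemannZeta (1 + x + 2 * I * y)‖ := by
  have := DirichletCharacter.norm_LFunction_product_ge_one (N := 1) (1 : DirichletCharacter ℂ 1) hx y
  simpa [DirichletCharacter.LFunctionTrivChar, DirichletCharacter.LFunction_modOne_eq] using this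

lemma Gr_inv : Gr (fun s => (riemannZeta s)⁻¹) := by
  intro ε hε
  set e := ε / 4 with he
  have he0 : 0 < e := by positivity
  obtain ⟨A', hA', hA⟩ := Gr_zetaD 0 e he0
  obtain ⟨B, hB0, hB⟩ := Gr_zetaD 1 e he0
  obtain ⟨K, hK0, hK⟩ := zeta_near
  simp only [iteratedDeriv_zero, iteratedDeriv_one] at hA hB
  set A := A' * 2 ^ e with hAd
  have hA0 : 0 < A := by positivity
  set c0 : ℝ := 1 / (K ^ 3 * A) with hc0
  have hc0' : 0 < c0 := by positivity
  have low : ∀ s : ℂ, 1 < s.re → s.re ≤ 2 → 2 ≤ |s.im| →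
      c0 * (s.re - 1) ^ 3 * |s.im| ^ (-e) ≤ ‖riemannZeta s‖ ^ 4 := by
    intro s h1 h2 h3
    set x := s.re - 1 with hx
    have hx0 : 0 < x := by linarith
    have h341 := three_four_one x hx0 s.im
    have es : (1 + (x:ℂ) + I * s.im) = s := by
      apply Complex.ext <;> simp [hx]
    rw [es] at h341
    have hz := hA (1 + (x:ℂ) + 2 * I * s.im) (by simp; linarith) (by simp; linarith) (by
      simp [abs_mul]; linarith)
    have him : (1 + (x:ℂ) + 2 * I * s.im).im = 2 * s.im := by simp
    rw [him, abs_mul, abs_two, Real.mul_rpow (by norm_num) (by positivity), ← mul_assoc] at hz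
    have hk := hK x hx0 (by linarith)
    have hT : 0 < |s.im| ^ e := Real.rpow_pos_of_pos (by linarith) _
    have : 1 ≤ (K/x)^3 * ‖riemannZeta s‖ ^ 4 * (A * |s.im| ^ e) := by
      refine h341.trans ?_
      gcongr
    rw [Real.rpow_neg (by positivity), hc0]
    have h9 : (1:ℝ) / (K ^ 3 * A) * x ^ 3 * (|s.im| ^ e)⁻¹ = ((K/x)^3 * (A * |s.im| ^ e))⁻¹ := by
      field_simp
    rw [h9]
    rw [inv_le_iff_one_le_mul₀ (by positivity)]
    linarith
  set c1 : ℝ := min 1 (c0 / (16 * B ^ 4)) with hc1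
  have hc1' : 0 < c1 := by rw [hc1]; positivity
  have hc11 : c1 ≤ 1 := min_le_left _ _
  have hc12 : 16 * B ^ 4 * c1 ≤ c0 := by
    have : c1 ≤ c0 / (16 * B ^ 4) := min_le_right _ _
    rw [le_div_iff₀ (by positivity)] at this
    linarith
  set c : ℝ := (c0 * c1 ^ 3) ^ (1/4 : ℝ) with hc
  have hcpos : 0 < c := by positivity
  have hc4 : c ^ 4 = c0 * c1 ^ 3 := by
    rw [hc, ← Real.rpow_natCast, ← Real.rpow_mul (by positivity)]; norm_num
  have hBc : 2 * B * c1 ≤ c := by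
    refine le_of_pow_le_pow_left₀ (n := 4) (by norm_num) hcpos.le ?_
    rw [hc4]
    calc (2 * B * c1) ^ 4 = 16 * B ^ 4 * c1 * c1 ^ 3 := by ring
      _ ≤ _ := by gcongr
  -- far case
  have far : ∀ s : ℂ, 1 < s.re → s.re ≤ 2 → 2 ≤ |s.im| → c1 * |s.im| ^ (-(5*e)) ≤ s.re - 1 →
      c * |s.im| ^ (-(4*e)) ≤ ‖riemannZeta s‖ := by
    intro s h1 h2 h3 h4
    refine le_of_pow_le_pow_left₀ (n := 4) (by norm_num) (norm_nonneg _) ?_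
    refine le_trans ?_ (low s h1 h2 h3)
    have hT : 0 < |s.im| := by linarith
    calc (c * |s.im| ^ (-(4*e))) ^ 4 = c0 * (c1 * |s.im| ^ (-(5*e))) ^ 3 * |s.im| ^ (-e) := by
          rw [mul_pow, mul_pow, hc4, ← Real.rpow_natCast (|s.im| ^ (-(4*e))), ← Real.rpow_natCast (|s.im| ^ (-(5*e))), ← Real.rpow_mul hT.le,
            ← Real.rpow_mul hT.le]
          have : -(4*e) * ((4:ℕ):ℝ) = -(5*e) * ((3:ℕ):ℝ) + -e := by push_cast; ring
          rw [this, Real.rpow_add hT]; ring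
      _ ≤ _ := by gcongr
  refine ⟨2 / c, by positivity, fun s h1 h2 h3 => ?_⟩
  have hT : 0 < |s.im| := by linarith
  have main : c / 2 * |s.im| ^ (-(4*e)) ≤ ‖riemannZeta s‖ := by
    by_cases h4 : c1 * |s.im| ^ (-(5*e)) ≤ s.re - 1
    · refine le_trans ?_ (far s h1 h2 h3 h4)
      gcongr; linarith
    · push Not at h4
      set η := c1 * |s.im| ^ (-(5*e)) with hη
      have hη0 : 0 < η := by positivity
      have hη1 : η ≤ 1 := by
        have : |s.im| ^ (-(5*e)) ≤ 1 := Real.rpow_le_one_of_one_le_of_nonpos (by linarith) (by linarith)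
        calc η ≤ 1 * 1 := by rw [hη]; gcongr
          _ = 1 := by norm_num
      set s' : ℂ := ⟨1 + η, s.im⟩ with hs'
      have f' := far s' (by simp [hs', hη0]) (by simp [hs']; linarith) h3 (by simp [hs', hη])
      have hd : ‖riemannZeta s' - riemannZeta s‖ ≤ B * |s.im| ^ e * ‖s' - s‖ := by
        refine Convex.norm_image_sub_le_of_norm_deriv_le (𝕜 := ℂ) (s := segment ℝ s s') (f := riemannZeta) ?_ ?_ (convex_segment _ _)
          (left_mem_segment _ _ _) (right_mem_segment _ _ _)
        · intro z hz
          have : z.im = s.im := by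
            obtain ⟨a, b, ha, hb, hab, rfl⟩ := hz
            simp [hs']
            rw [← add_mul, hab, one_mul]
          refine differentiableAt_riemannZeta ?_
          rintro rfl
          simp at this
          rw [← this] at h3; norm_num at h3
        · intro z hz
          have him : z.im = s.im := by
            obtain ⟨a, b, ha, hb, hab, rfl⟩ := hz
            simp [hs']
            rw [← add_mul, hab, one_mul]
          have hre : s.re ≤ z.re ∧ z.re ≤ 1 + η := by
            obtain ⟨a, b, ha, hb, hab, rfl⟩ := hz
            have : a = 1 - b := by linarith
            subst this
            simp [hs']
            constructor
            · nlinarith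
            · nlinarith
          have := hB z (by linarith) (by linarith) (by rw [him]; exact h3)
          rwa [him] at this
      have hss : ‖s' - s‖ ≤ η := by
        have : s' - s = ((1 + η - s.re : ℝ) : ℂ) := by
          apply Complex.ext <;> simp [hs']
        rw [this, Complex.norm_real, Real.norm_eq_abs, abs_of_nonneg (by linarith)]
        linarith
      have h5 : B * |s.im| ^ e * ‖s' - s‖ ≤ c / 2 * |s.im| ^ (-(4*e)) := by
        calc _ ≤ B * |s.im| ^ e * η := by gcongr
          _ = B * c1 * |s.im| ^ (-(4*e)) := by
            rw [hη]
            have : -(4*e) = e + -(5*e) := by ring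
            rw [this, Real.rpow_add hT]; ring
          _ ≤ _ := by gcongr; linarith
      have h6 := norm_sub_norm_le (riemannZeta s') (riemannZeta s)
      have h7 : s'.im = s.im := rfl
      rw [h7] at f'
      linarith
  rw [norm_inv]
  have hp : 0 < c / 2 * |s.im| ^ (-(4*e)) := by positivity
  calc ‖riemannZeta s‖⁻¹ ≤ (c / 2 * |s.im| ^ (-(4*e)))⁻¹ := inv_anti₀ hp main
    _ = 2 / c * |s.im| ^ ε := by
      have : ε = 4 * e := by rw [he]; ring
      rw [this, Real.rpow_neg hT.le]
      field_simp

inductive Good : (ℂ → ℂ) → Prop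
  | zeta (j : ℕ) : Good (iteratedDeriv j riemannZeta)
  | inv : Good (fun s => (riemannZeta s)⁻¹)
  | add {f g : ℂ → ℂ} : Good f → Good g → Good (fun s => f s + g s)
  | mul {f g : ℂ → ℂ} : Good f → Good g → Good (fun s => f s * g s)
  | neg {f : ℂ → ℂ} : Good f → Good (fun s => - f s)

lemma Good.gr {f : ℂ → ℂ} (h : Good f) : Gr f := by
  induction h with
  | zeta j => exact Gr_zetaD j
  | inv => exact Gr_inv
  | add _ _ h1 h2 => exact h1.add h2
  | mul _ _ h1 h2 => exact h1.mul h2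
  | neg _ h => exact h.neg

lemma ne_one {s : ℂ} (hs : 1 < s.re) : s ≠ 1 := by rintro rfl; simp at hs

lemma Good.deriv {f : ℂ → ℂ} (h : Good f) : ∃ g, Good g ∧ ∀ s : ℂ, 1 < s.re → HasDerivAt f (g s) s := by
  induction h with
  | zeta j =>
    refine ⟨_, Good.zeta (j+1), fun s hs => ?_⟩
    rw [iteratedDeriv_succ]
    apply DifferentiableAt.hasDerivAt
    have ha : AnalyticAt ℂ riemannZeta s := analyticOn_riemannZeta s (by simpa using ne_one hs)
    have := ha.iterated_deriv j
    rw [← iteratedDeriv_eq_iterate] at this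
    exact this.differentiableAt
  | inv =>
    refine ⟨_, Good.neg ((Good.zeta 1).mul (Good.inv.mul Good.inv)), fun s hs => ?_⟩
    have hz : riemannZeta s ≠ 0 := riemannZeta_ne_zero_of_one_le_re hs.le
    have := (differentiableAt_riemannZeta (ne_one hs)).hasDerivAt.inv hz
    have e : -(iteratedDeriv 1 riemannZeta s * ((riemannZeta s)⁻¹ * (riemannZeta s)⁻¹)) =
        -_root_.deriv riemannZeta s / riemannZeta s ^ 2 := by
      rw [iteratedDeriv_one]
      field_simp
    beta_reduce
    rw [e]
    exact this
  | add _ _ h1 h2 =>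
    obtain ⟨g1, k1, l1⟩ := h1
    obtain ⟨g2, k2, l2⟩ := h2
    exact ⟨_, k1.add k2, fun s hs => (l1 s hs).add (l2 s hs)⟩
  | @mul f1 f2 m1 m2 h1 h2 =>
    obtain ⟨g1, k1, l1⟩ := h1
    obtain ⟨g2, k2, l2⟩ := h2
    exact ⟨_, (k1.mul m2).add (m1.mul k2), fun s hs => (l1 s hs).mul (l2 s hs)⟩
  | neg _ h =>
    obtain ⟨g1, k1, l1⟩ := h
    exact ⟨_, k1.neg, fun s hs => (l1 s hs).neg⟩

lemma Good.iter {f : ℂ → ℂ} (h : Good f) (k : ℕ) : ∃ g, Good g ∧ ∀ s : ℂ, 1 < s.re → iteratedDeriv k f s = g s := by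
  induction k with
  | zero => exact ⟨f, h, fun s _ => by simp⟩
  | succ k ih =>
    obtain ⟨g, hg, hgs⟩ := ih
    obtain ⟨g', hg', h'⟩ := hg.deriv
    refine ⟨g', hg', fun s hs => ?_⟩
    rw [iteratedDeriv_succ]
    have : iteratedDeriv k f =ᶠ[𝓝 s] g := by
      have : {z : ℂ | 1 < z.re} ∈ 𝓝 s := (isOpen_lt continuous_const continuous_re).mem_nhds hs
      filter_upwards [this] with z hz using hgs z hz
    rw [this.deriv_eq, (h' s hs).deriv]

noncomputable def FF (s : ℂ) : ℂ := -(deriv riemannZeta₁ s / riemannZeta₁ s) - riemannZeta₀ s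

lemma FF_eq {s : ℂ} (hs : 1 < s.re) : FF s = -(deriv riemannZeta s * (riemannZeta s)⁻¹) + -riemannZeta s := by
  have h1 := ne_one hs
  have h2 := sub_ne_zero.2 h1
  have hz : riemannZeta s ≠ 0 := riemannZeta_ne_zero_of_one_le_re hs.le
  have hd := deriv_riemannZeta_eq_neg_inv_sub_sq_mul_add h1
  have e1 := riemannZeta_eq_inv_sub_mul h1
  have e0 := riemannZeta_eq_inv_sub_add h1
  have hz1 : riemannZeta₁ s ≠ 0 := by
    intro h; rw [h] at e1; simp at e1; exact hz e1
  have e0' : riemannZeta₀ s = riemannZeta s - (s-1)⁻¹ := by rw [e0]; ring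
  rw [FF, e0', hd, e1]
  field_simp
  ring

lemma zeta1_ne {s : ℂ} (hs : 1 ≤ s.re) : riemannZeta₁ s ≠ 0 := by
  by_cases h1 : s = 1
  · subst h1; simp
  intro h
  have e1 := riemannZeta_eq_inv_sub_mul h1
  rw [h, mul_zero] at e1
  exact riemannZeta_ne_zero_of_one_le_re hs e1

lemma FF_bound (k : ℕ) : ∃ C : ℝ, 0 < C ∧ ∀ s : ℂ, 1 < s.re → s.re ≤ 2 →
    ‖iteratedDeriv k FF s‖ ≤ C * (1 + |s.im|) ^ (1/2 : ℝ) := by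
  -- large
  have hG : Good (fun s => -(iteratedDeriv 1 riemannZeta s * (riemannZeta s)⁻¹) + -(iteratedDeriv 0 riemannZeta s)) :=
    ((Good.zeta 1).mul Good.inv).neg.add (Good.zeta 0).neg
  obtain ⟨g, hg, hgs⟩ := hG.iter k
  obtain ⟨C1, hC1, h1⟩ := hg.gr (1/2) (by norm_num)
  -- small
  set K : Set ℂ := Set.Icc (1:ℝ) 2 ×ℂ Set.Icc (-2:ℝ) 2
  have hK : IsCompact K := isCompact_Icc.reProdIm isCompact_Icc
  have hcont : ContinuousOn (iteratedDeriv k FF) K := by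
    intro s hs
    have hs1 : 1 ≤ s.re := (mem_reProdIm.1 hs).1.1
    have a1 : AnalyticAt ℂ riemannZeta₁ s := differentiable_riemannZeta₁.analyticAt s
    have a0 : AnalyticAt ℂ riemannZeta₀ s := differentiable_riemannZeta₀.analyticAt s
    have : AnalyticAt ℂ FF s := ((a1.deriv.div a1 (zeta1_ne hs1)).neg).sub a0
    have := this.iterated_deriv k
    rw [← iteratedDeriv_eq_iterate] at this
    exact this.continuousAt.continuousWithinAt
  obtain ⟨C2, hC2⟩ := hK.exists_bound_of_continuousOn hcont
  refine ⟨C1 + |C2|, by positivity, fun s hs1 hs2 => ?_⟩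
  have hone : 1 ≤ (1 + |s.im|) ^ (1/2 : ℝ) := Real.one_le_rpow (by linarith [abs_nonneg s.im]) (by norm_num)
  by_cases h : 2 ≤ |s.im|
  · have e : iteratedDeriv k FF s = g s := by
      rw [← hgs s hs1]
      apply Filter.EventuallyEq.iteratedDeriv_eq
      have : {z : ℂ | 1 < z.re} ∈ 𝓝 s := (isOpen_lt continuous_const continuous_re).mem_nhds hs1
      filter_upwards [this] with z hz
      rw [FF_eq hz]; simp
    rw [e]
    refine (h1 s hs1 hs2 h).trans ?_
    calc C1 * |s.im| ^ (1/2:ℝ) ≤ C1 * (1 + |s.im|) ^ (1/2:ℝ) := by gcongr; linarith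
      _ ≤ _ := by gcongr; linarith [abs_nonneg C2]
  · push Not at h
    have := abs_le.1 h.le
    have := hC2 s (mem_reProdIm.2 ⟨⟨hs1.le, hs2⟩, this⟩)
    nlinarith [le_abs_self C2, abs_nonneg C2]
end Stmt9

set_option linter.all false
namespace Stmt9
open Complex Filter Topology MeasureTheory

noncomputable def bb (k n : ℕ) : ℝ := (ArithmeticFunction.vonMangoldt n - 1) * Real.log n ^ k

noncomputable def ff (n : ℕ) : ℂ := (ArithmeticFunction.vonMangoldt n : ℂ) - 1

lemma ff_iter (k n : ℕ) : (LSeries.logMul^[k] ff) n = (bb k n : ℂ) := by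
  induction k with
  | zero => simp [ff, bb]
  | succ k ih =>
    rw [Function.iterate_succ_apply', LSeries.logMul, ih, bb, bb]
    push_cast
    ring

lemma ff_summable {s : ℂ} (hs : 1 < s.re) : LSeriesSummable ff s := by
  have h1 := ArithmeticFunction.LSeriesSummable_vonMangoldt hs
  have h2 : LSeriesSummable 1 s := LSeriesSummable_one_iff.2 hs
  exact h1.sub h2

lemma ff_abs : LSeries.abscissaOfAbsConv ff ≤ 1 := by
  apply LSeries.abscissaOfAbsConv_le_of_forall_lt_LSeriesSummable
  intro y hy
  exact ff_summable (by simpa using hy)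

lemma ff_abs_lt {s : ℂ} (hs : 1 < s.re) : LSeries.abscissaOfAbsConv ff < s.re :=
  lt_of_le_of_lt ff_abs (by exact_mod_cast hs)

lemma ff_LSeries {s : ℂ} (hs : 1 < s.re) : LSeries ff s = FF s := by
  have h1 := ArithmeticFunction.LSeriesSummable_vonMangoldt hs
  have h2 : LSeriesSummable 1 s := LSeriesSummable_one_iff.2 hs
  have e := LSeries_sub h1 h2
  have : ff = (fun n => (ArithmeticFunction.vonMangoldt n : ℂ)) - 1 := by ext n; simp [ff]
  rw [this, e, ArithmeticFunction.LSeries_vonMangoldt_eq_deriv_riemannZeta_div hs,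
    LSeries_one_eq_riemannZeta hs, FF_eq hs]
  ring

lemma bb_summable (k : ℕ) {s : ℂ} (hs : 1 < s.re) : LSeriesSummable (fun n => (bb k n : ℂ)) s := by
  have : (fun n => (bb k n : ℂ)) = LSeries.logMul^[k] ff := by ext n; rw [ff_iter]
  rw [this]
  apply LSeriesSummable_of_abscissaOfAbsConv_lt_re
  rw [LSeries.absicssaOfAbsConv_logPowMul]
  exact ff_abs_lt hs

lemma bb_bound (k : ℕ) : ∃ C : ℝ, 0 < C ∧ ∀ s : ℂ, 1 < s.re → s.re ≤ 2 →
    ‖LSeries (fun n => (bb k n : ℂ)) s‖ ≤ C * (1 + |s.im|) ^ (1/2 : ℝ) := by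
  obtain ⟨C, hC, h⟩ := FF_bound k
  refine ⟨C, hC, fun s h1 h2 => ?_⟩
  have : (fun n => (bb k n : ℂ)) = LSeries.logMul^[k] ff := by ext n; rw [ff_iter]
  rw [this]
  have e := LSeries_iteratedDeriv (f := ff) k (ff_abs_lt h1)
  have e2 : iteratedDeriv k (LSeries ff) s = iteratedDeriv k FF s := by
    apply Filter.EventuallyEq.iteratedDeriv_eq
    have : {z : ℂ | 1 < z.re} ∈ 𝓝 s := (isOpen_lt continuous_const continuous_re).mem_nhds h1
    filter_upwards [this] with z hz using ff_LSeries hz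
  have e3 : ‖LSeries (LSeries.logMul^[k] ff) s‖ = ‖iteratedDeriv k (LSeries ff) s‖ := by
    rw [e, norm_mul]; simp
  rw [e3, e2]
  exact h s h1 h2

noncomputable def ker (u : ℝ) : ℂ :=
  Set.indicator (Set.Ioc 0 1) (fun _ => 1 : ℝ → ℂ) u - Set.indicator (Set.Ioc 0 1) (fun t => ↑t ^ (1:ℂ) : ℝ → ℂ) u

lemma ker_mellin {s : ℂ} (hs : 0 < s.re) : HasMellin ker s (1 / s - 1 / (s + 1)) := by
  have h1 := hasMellin_one_Ioc hs
  have h2 := hasMellin_cpow_Ioc 1 (s := s) (by simp; linarith)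
  have := hasMellin_sub h1.1 h2.1
  rw [h1.2, h2.2] at this
  exact this

lemma ker_eq {u : ℝ} (hu : 0 < u) : ker u = ((max (1 - u) 0 : ℝ) : ℂ) := by
  by_cases h : u ≤ 1
  · simp [ker, hu, h]
  · push Not at h
    have : ¬ (u ≤ 1) := by linarith
    rw [max_eq_right (by linarith)]
    simp [ker, this]

lemma M_norm {c y : ℝ} (hc : 1 < c) :
    ‖1 / ((c:ℂ) + y * I) - 1 / ((c:ℂ) + y * I + 1)‖ ≤ (1 + y ^ 2)⁻¹ := by
  set s : ℂ := (c:ℂ) + y * I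
  have hre : s.re = c := by simp [s]
  have him : s.im = y := by simp [s]
  have hs : s ≠ 0 := by intro h; rw [h] at hre; simp at hre; linarith
  have hs1 : s + 1 ≠ 0 := by
    intro h
    have : (s+1).re = 0 := by rw [h]; simp
    simp [hre] at this; linarith
  have e : 1 / s - 1 / (s + 1) = (s * (s+1))⁻¹ := by field_simp; ring
  rw [e, norm_inv, norm_mul]
  have n1 : ‖s‖ ^ 2 = c ^ 2 + y ^ 2 := by rw [← Complex.normSq_eq_norm_sq, Complex.normSq_apply, hre, him]; ring
  have n2 : ‖s‖ ≤ ‖s+1‖ := by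
    refine le_of_pow_le_pow_left₀ (n := 2) (by norm_num) (norm_nonneg _) ?_
    rw [n1, ← Complex.normSq_eq_norm_sq, Complex.normSq_apply]
    simp [hre, him]; nlinarith
  apply inv_anti₀ (by positivity)
  nlinarith [norm_nonneg s]

lemma M_cont {c : ℝ} (hc : 1 < c) :
    Continuous (fun y : ℝ => 1 / ((c:ℂ) + y * I) - 1 / ((c:ℂ) + y * I + 1)) := by
  have h1 : ∀ y : ℝ, (c:ℂ) + y * I ≠ 0 := by
    intro y h
    have : ((c:ℂ) + y * I).re = 0 := by rw [h]; simp
    simp at this; linarith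
  have h2 : ∀ y : ℝ, (c:ℂ) + y * I + 1 ≠ 0 := by
    intro y h
    have : ((c:ℂ) + y * I + 1).re = 0 := by rw [h]; simp
    simp at this; linarith
  apply Continuous.sub <;> apply Continuous.div <;> first | fun_prop | assumption

lemma M_int {c : ℝ} (hc : 1 < c) :
    Integrable (fun y : ℝ => 1 / ((c:ℂ) + y * I) - 1 / ((c:ℂ) + y * I + 1)) := by
  refine Integrable.mono' integrable_inv_one_add_sq (M_cont hc).aestronglyMeasurable ?_
  exact Eventually.of_forall (fun y => M_norm hc)

lemma ker_inv {c u : ℝ} (hc : 1 < c) (hu : 0 < u) :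
    ∫ y : ℝ, (u : ℂ) ^ (-((c:ℂ) + y * I)) * (1 / ((c:ℂ) + y * I) - 1 / ((c:ℂ) + y * I + 1)) =
      2 * Real.pi * ((max (1 - u) 0 : ℝ) : ℂ) := by
  have hm : ∀ y : ℝ, mellin ker ((c:ℂ) + y * I) = 1 / ((c:ℂ) + y * I) - 1 / ((c:ℂ) + y * I + 1) := by
    intro y
    exact (ker_mellin (by simp; linarith)).2
  have h := mellinInv_mellin_eq c ker hu (ker_mellin (by simp; linarith)).1 ?_ ?_
  · rw [mellinInv, ker_eq hu] at h
    simp_rw [hm, smul_eq_mul] at h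
    rw [← h]
    rw [real_smul]
    push_cast
    have : (Real.pi : ℂ) ≠ 0 := by exact_mod_cast Real.pi_ne_zero
    generalize (∫ y : ℝ, (u : ℂ) ^ (-((c:ℂ) + y * I)) * (1 / ((c:ℂ) + y * I) - 1 / ((c:ℂ) + y * I + 1))) = Q
    field_simp
  · have := M_int hc
    unfold VerticalIntegrable
    simp_rw [hm]
    exact this
  · have : ContinuousAt (fun u : ℝ => ((max (1 - u) 0 : ℝ) : ℂ)) u := by fun_prop
    refine this.congr ?_
    filter_upwards [lt_mem_nhds hu] with v hv
    rw [ker_eq hv]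

lemma W_bound (k : ℕ) : ∃ C : ℝ, 0 < C ∧ ∀ x : ℝ, 3 ≤ x →
    |∑ n ∈ Finset.Icc 1 ⌊x⌋₊, bb k n * (x - n)| ≤ C * x ^ 2 := by
  obtain ⟨C, hC, hb⟩ := bb_bound k
  have hint : Integrable (fun y : ℝ => (1 + ‖y‖ ^ 2) ^ (-(3/2:ℝ)/2)) :=
    integrable_rpow_neg_one_add_norm_sq (by simp; norm_num)
  set J := ∫ y : ℝ, (1 + ‖y‖ ^ 2) ^ (-(3/2:ℝ)/2) with hJ
  have hJ0 : 0 ≤ J := integral_nonneg (fun y => by positivity)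
  refine ⟨Real.exp 1 * (2 * C) * J + 1, by positivity, fun x hx => ?_⟩
  have hx0 : 0 < x := by linarith
  have hlog : 1 < Real.log x := by
    rw [Real.lt_log_iff_exp_lt hx0]
    exact lt_of_lt_of_le (by linarith [Real.exp_one_lt_d9]) hx
  set c : ℝ := 1 + 1 / Real.log x with hc
  have hc1 : 1 < c := by rw [hc]; have : 0 < 1 / Real.log x := by positivity
                         linarith
  have hc2 : c ≤ 2 := by
    have : 1 / Real.log x ≤ 1 := by rw [div_le_one (by linarith)]; exact hlog.le
    linarith
  have hxc : x ^ c = Real.exp 1 * x := by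
    rw [hc, Real.rpow_add hx0, Real.rpow_one, Real.rpow_def_of_pos hx0]
    have : Real.log x * (1 / Real.log x) = 1 := by field_simp
    rw [this]; ring
  set M : ℝ → ℂ := fun y => 1 / ((c:ℂ) + y * I) - 1 / ((c:ℂ) + y * I + 1) with hM
  set g : ℝ → ℂ := fun y => (x:ℂ) ^ ((c:ℂ) + y * I) * M y with hg
  have hgn : ∀ y, ‖g y‖ = x ^ c * ‖M y‖ := by
    intro y
    rw [hg]; simp only [norm_mul]
    rw [norm_cpow_eq_rpow_re_of_pos hx0]; simp
  have hxcont : Continuous (fun y : ℝ => (x:ℂ) ^ ((c:ℂ) + y * I)) := by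
    refine Continuous.const_cpow (by fun_prop) (Or.inl (by exact_mod_cast hx0.ne'))
  have hgi : Integrable g := by
    refine Integrable.mono' ((M_int hc1).norm.const_mul (x ^ c)) (hxcont.mul (M_cont hc1)).aestronglyMeasurable ?_
    exact Eventually.of_forall (fun y => (hgn y).le)
  set b : ℕ → ℂ := fun n => (bb k n : ℂ) with hbd
  set F : ℕ → ℝ → ℂ := fun n y => LSeries.term b ((c:ℂ) + y * I) n * g y with hF
  have hterm : ∀ (n : ℕ) (y : ℝ), ‖LSeries.term b ((c:ℂ) + y * I) n‖ = ‖LSeries.term b c n‖ := by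
    intro n y
    rw [LSeries.norm_term_eq, LSeries.norm_term_eq]; simp
  have hFn : ∀ (n : ℕ) (y : ℝ), ‖F n y‖ = ‖LSeries.term b c n‖ * ‖g y‖ := by
    intro n y; rw [hF]; simp only [norm_mul, hterm]
  have hFi : ∀ n, Integrable (F n) := by
    intro n
    refine Integrable.mono' (hgi.norm.const_mul (‖LSeries.term b c n‖)) ?_ (Eventually.of_forall (fun y => (hFn n y).le))
    refine AEStronglyMeasurable.mul ?_ hgi.aestronglyMeasurable
    apply Continuous.aestronglyMeasurable
    rcases eq_or_ne n 0 with rfl | hn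
    · simp; exact continuous_const
    · simp only [LSeries.term_of_ne_zero hn]
      refine Continuous.div continuous_const (Continuous.const_cpow (by fun_prop) (Or.inl (by exact_mod_cast hn))) ?_
      intro y; rw [Complex.cpow_ne_zero_iff]; left; exact_mod_cast hn
  have hsum := hasSum_integral_of_summable_integral_norm hFi (by
    simp_rw [hFn, integral_const_mul]
    exact (bb_summable k (s := (c:ℂ)) (by simpa using hc1)).norm.mul_right _)
  have hFint : ∀ n : ℕ, n ≠ 0 → ∫ y, F n y = 2 * Real.pi * ((bb k n * max (1 - n / x) 0 : ℝ) : ℂ) := by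
    intro n hn
    have hn0 : (0:ℝ) < n := by exact_mod_cast Nat.pos_of_ne_zero hn
    have := ker_inv hc1 (u := n / x) (by positivity)
    have e : ∀ y : ℝ, F n y = b n * (((n / x : ℝ) : ℂ) ^ (-((c:ℂ) + y * I)) * (1 / ((c:ℂ) + y * I) - 1 / ((c:ℂ) + y * I + 1))) := by
      intro y
      rw [hF]
      simp only [LSeries.term_of_ne_zero hn, hg, hM]
      have h1 : ((n / x : ℝ) : ℂ) ^ (-((c:ℂ) + y * I)) = ((n:ℂ) ^ ((c:ℂ) + y * I))⁻¹ * (x:ℂ) ^ ((c:ℂ) + y * I) := by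
        rw [div_eq_mul_inv, Complex.ofReal_mul, Complex.mul_cpow_ofReal_nonneg hn0.le (by positivity), Complex.cpow_neg,
          Complex.ofReal_inv, Complex.inv_cpow, Complex.cpow_neg, inv_inv]
        · simp
        · rw [Complex.arg_ofReal_of_nonneg hx0.le]; exact Real.pi_pos.ne
      rw [h1]; ring
    simp_rw [e]
    rw [integral_const_mul, this]
    push_cast
    ring
  have hfin : HasSum (fun n => ∫ y, F n y) (∑ n ∈ Finset.Icc 1 ⌊x⌋₊, ∫ y, F n y) := by
    apply hasSum_sum_of_ne_finset_zero
    intro n hn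
    rcases eq_or_ne n 0 with rfl | hn0
    · simp [hF]
    · rw [hFint n hn0, max_eq_right]
      · simp
      · have : ⌊x⌋₊ < n := by
          by_contra h
          exact hn (Finset.mem_Icc.2 ⟨Nat.one_le_iff_ne_zero.2 hn0, by omega⟩)
        have := Nat.lt_of_floor_lt this
        rw [sub_nonpos, one_le_div hx0]; exact this.le
  have heq := hfin.unique hsum
  have hval : ∑ n ∈ Finset.Icc 1 ⌊x⌋₊, ∫ y, F n y = 2 * Real.pi * ((1 / x * ∑ n ∈ Finset.Icc 1 ⌊x⌋₊, bb k n * (x - n) : ℝ) : ℂ) := by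
    rw [Finset.mul_sum]
    push_cast
    rw [Finset.mul_sum]
    refine Finset.sum_congr rfl (fun n hn => ?_)
    rw [Finset.mem_Icc] at hn
    have hnx : (n:ℝ) ≤ x := (Nat.le_floor_iff hx0.le).1 hn.2
    rw [hFint n (by omega), max_eq_left]
    · push_cast
      have : (x:ℂ) ≠ 0 := by exact_mod_cast hx0.ne'
      field_simp
    · rw [sub_nonneg, div_le_one hx0]; exact hnx
  have hRHS : ‖∫ y, ∑' n, F n y‖ ≤ (Real.exp 1 * x) * (2 * C) * J := by
    rw [hJ, ← integral_const_mul]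
    refine norm_integral_le_of_norm_le (hint.const_mul _) (Eventually.of_forall (fun y => ?_))
    have e : ∑' n, F n y = LSeries b ((c:ℂ) + y * I) * g y := by
      rw [hF, LSeries, tsum_mul_right]
    rw [e, norm_mul, hgn, hxc]
    have h1 := hb ((c:ℂ) + y * I) (by simp; linarith) (by simp; linarith)
    have him : ((c:ℂ) + y * I).im = y := by simp
    rw [him] at h1
    have h2 : ‖M y‖ ≤ (1 + y^2)⁻¹ := M_norm hc1
    have h3 : (1 + |y|) ^ (1/2:ℝ) ≤ 2 * (1 + y^2) ^ (1/4:ℝ) := by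
      have : (1 + |y|) ≤ (4 * (1 + y^2)) ^ (1/2:ℝ) := by
        rw [← Real.sqrt_eq_rpow]
        apply Real.le_sqrt_of_sq_le
        nlinarith [sq_abs y, abs_nonneg y, sq_nonneg (|y| - 1)]
      calc (1 + |y|) ^ (1/2:ℝ) ≤ ((4 * (1 + y^2)) ^ (1/2:ℝ)) ^ (1/2:ℝ) := by gcongr
        _ = 4 ^ (1/4:ℝ) * (1 + y^2) ^ (1/4:ℝ) := by
          rw [← Real.rpow_mul (by positivity), Real.mul_rpow (by norm_num) (by positivity)]; norm_num
        _ ≤ 2 * (1 + y^2) ^ (1/4:ℝ) := by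
          gcongr
          have : (4:ℝ) ^ (1/4:ℝ) ≤ 4 ^ (1/2:ℝ) := Real.rpow_le_rpow_of_exponent_le (by norm_num) (by norm_num)
          have e4 : (4:ℝ) ^ (1/2:ℝ) = 2 := by
            rw [← Real.sqrt_eq_rpow, show (4:ℝ) = 2^2 by norm_num, Real.sqrt_sq (by norm_num)]
          linarith
    have h4 : (1 + ‖y‖ ^ 2) ^ (-(3/2:ℝ)/2) = (1 + y^2) ^ (1/4:ℝ) * (1+y^2)⁻¹ := by
      rw [Real.norm_eq_abs, sq_abs, ← Real.rpow_neg_one, ← Real.rpow_add (by positivity)]; norm_num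
    rw [h4]
    calc _ ≤ (C * (2 * (1 + y^2) ^ (1/4:ℝ))) * (Real.exp 1 * x * (1 + y^2)⁻¹) := by
          gcongr
          exact h1.trans (by gcongr)
      _ = _ := by ring
  rw [← heq, hval, norm_mul, Complex.norm_real, norm_mul] at hRHS
  simp only [Complex.norm_ofNat, Complex.norm_real, Real.norm_eq_abs, abs_of_pos Real.pi_pos, abs_mul, abs_of_pos (by positivity : 0 < 1 / x)] at hRHS
  set S := |∑ n ∈ Finset.Icc 1 ⌊x⌋₊, bb k n * (x - n)|
  have hS : 0 ≤ S := abs_nonneg _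
  have : 1 * (1 / x * S) ≤ 2 * Real.pi * (1 / x * S) := by
    gcongr
    linarith [Real.pi_gt_three]
  have h6 : 1 / x * S ≤ Real.exp 1 * x * (2 * C) * J := by linarith
  have h7 : S ≤ x * (Real.exp 1 * x * (2 * C) * J) := by
    rw [one_div, inv_mul_le_iff₀ hx0] at h6
    exact h6
  nlinarith [sq_nonneg x]
end Stmt9

set_option linter.all false
namespace Stmt9
open Filter Topology MeasureTheory

lemma sum_split (f : ℕ → ℝ) {a b : ℕ} (h : a ≤ b) :
    ∑ n ∈ Finset.Icc 1 b, f n = ∑ n ∈ Finset.Icc 1 a, f n + ∑ n ∈ Finset.Ioc a b, f n := by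
  have e : ∀ c : ℕ, Finset.Icc 1 c = Finset.Ioc 0 c := by intro c; ext; simp [Nat.one_le_iff_ne_zero, Nat.pos_iff_ne_zero]
  rw [e, e, Finset.sum_Ioc_consecutive f (Nat.zero_le a) h]

lemma bb_lower (k n : ℕ) : -(Real.log n ^ k) ≤ bb k n := by
  have h1 : 0 ≤ Real.log n ^ k := pow_nonneg (Real.log_natCast_nonneg n) k
  have h2 : 0 ≤ ArithmeticFunction.vonMangoldt n := ArithmeticFunction.vonMangoldt_nonneg
  unfold bb
  nlinarith

lemma short_sum (k : ℕ) {x h L : ℝ} (hx : 0 ≤ x) (hh : 0 < h) (w : ℕ → ℝ)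
    (hw : ∀ n : ℕ, x < n → (n:ℝ) ≤ x + h → 0 ≤ w n ∧ w n ≤ h)
    (hL : ∀ n : ℕ, x < n → (n:ℝ) ≤ x + h → Real.log n ^ k ≤ L) (hL0 : 0 ≤ L) :
    -(L * h * (h + 1)) ≤ ∑ n ∈ Finset.Ioc ⌊x⌋₊ ⌊x + h⌋₊, bb k n * w n := by
  have h1 : ∀ n ∈ Finset.Ioc ⌊x⌋₊ ⌊x + h⌋₊, -(L * h) ≤ bb k n * w n := by
    intro n hn
    rw [Finset.mem_Ioc] at hn
    have a1 : x < n := Nat.lt_of_floor_lt hn.1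
    have a2 : (n:ℝ) ≤ x + h := (Nat.le_floor_iff (by positivity)).1 hn.2
    obtain ⟨w0, w1⟩ := hw n a1 a2
    have hl := hL n a1 a2
    have hb := bb_lower k n
    calc -(L * h) ≤ -(L * w n) := by nlinarith
      _ = (-L) * w n := by ring
      _ ≤ bb k n * w n := by apply mul_le_mul_of_nonneg_right _ w0; linarith
  have h2 := Finset.card_nsmul_le_sum _ _ _ h1
  rw [Nat.card_Ioc, nsmul_eq_mul] at h2
  refine le_trans ?_ h2
  have h3 : ((⌊x + h⌋₊ - ⌊x⌋₊ : ℕ) : ℝ) ≤ h + 1 := by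
    have : ⌊x⌋₊ ≤ ⌊x + h⌋₊ := Nat.floor_le_floor (by linarith)
    rw [Nat.cast_sub this]
    have := Nat.floor_le (show 0 ≤ x + h by linarith)
    have := Nat.lt_floor_add_one x
    linarith
  have : 0 ≤ L * h := by positivity
  nlinarith

lemma B_aux (k : ℕ) : ∃ C : ℝ, 0 < C ∧ ∀ x h : ℝ, 0 < h → 3 ≤ x - h →
    |∑ n ∈ Finset.Icc 1 ⌊x⌋₊, bb k n| ≤ C * x ^ 2 / h + Real.log (2 * x) ^ k * (h + 1) := by
  obtain ⟨C, hC, hW⟩ := W_bound k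
  refine ⟨5 * C, by positivity, fun x h hh hxh => ?_⟩
  have hx : 3 ≤ x := by linarith
  set B := ∑ n ∈ Finset.Icc 1 ⌊x⌋₊, bb k n with hB
  set L := Real.log (2 * x) ^ k with hL
  have hL0 : 0 ≤ L := pow_nonneg (Real.log_nonneg (by linarith)) k
  have hlog : ∀ n : ℕ, 0 < (n:ℝ) → (n:ℝ) ≤ 2 * x → Real.log n ^ k ≤ L := by
    intro n h0 h1
    exact pow_le_pow_left₀ (Real.log_natCast_nonneg n) (Real.log_le_log h0 h1) k
  have up : h * B ≤ 5 * C * x ^ 2 + L * h * (h + 1) := by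
    have s := sum_split (fun n => bb k n * (x + h - n)) (a := ⌊x⌋₊) (b := ⌊x + h⌋₊) (Nat.floor_le_floor (by linarith))
    have s2 := short_sum k (x := x) (L := L) (by linarith) hh (fun n => x + h - n)
      (fun n a b => ⟨by linarith, by linarith⟩) (fun n a b => hlog n (by linarith) (by linarith)) hL0
    have w1 := hW x hx
    have w2 := hW (x + h) (by linarith)
    have e : ∑ n ∈ Finset.Icc 1 ⌊x⌋₊, bb k n * (x + h - n) = ∑ n ∈ Finset.Icc 1 ⌊x⌋₊, bb k n * (x - n) + h * B := by
      rw [hB, Finset.mul_sum, ← Finset.sum_add_distrib]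
      refine Finset.sum_congr rfl (fun n _ => by ring)
    rw [abs_le] at w1 w2
    have : C * (x + h) ^ 2 ≤ C * (4 * x ^ 2) := by
      apply mul_le_mul_of_nonneg_left _ hC.le; nlinarith
    linarith [w1.1, w2.2]
  have lo : -(5 * C * x ^ 2 + L * h * (h + 1)) ≤ h * B := by
    have s := sum_split (fun n => bb k n * (x - n)) (a := ⌊x - h⌋₊) (b := ⌊x⌋₊) (Nat.floor_le_floor (by linarith))
    have s3 := sum_split (fun n => bb k n) (a := ⌊x - h⌋₊) (b := ⌊x⌋₊) (Nat.floor_le_floor (by linarith))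
    have s2 := short_sum k (x := x - h) (L := L) (by linarith) hh (fun n => h - (x - n))
      (fun n a b => ⟨by linarith, by linarith⟩) (fun n a b => hlog n (by linarith) (by linarith)) hL0
    have w1 := hW x hx
    have w2 := hW (x - h) (by linarith)
    rw [sub_add_cancel] at s2
    have e : ∑ n ∈ Finset.Icc 1 ⌊x - h⌋₊, bb k n * (x - n) = ∑ n ∈ Finset.Icc 1 ⌊x - h⌋₊, bb k n * (x - h - n) + h * ∑ n ∈ Finset.Icc 1 ⌊x - h⌋₊, bb k n := by
      rw [Finset.mul_sum, ← Finset.sum_add_distrib]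
      refine Finset.sum_congr rfl (fun n _ => by ring)
    have e2 : ∑ n ∈ Finset.Ioc ⌊x - h⌋₊ ⌊x⌋₊, bb k n * (h - (x - n)) = h * ∑ n ∈ Finset.Ioc ⌊x - h⌋₊ ⌊x⌋₊, bb k n - ∑ n ∈ Finset.Ioc ⌊x - h⌋₊ ⌊x⌋₊, bb k n * (x - n) := by
      rw [Finset.mul_sum, ← Finset.sum_sub_distrib]
      refine Finset.sum_congr rfl (fun n _ => by ring)
    rw [abs_le] at w1 w2
    have : C * (x - h) ^ 2 ≤ C * (4 * x ^ 2) := by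
      apply mul_le_mul_of_nonneg_left _ hC.le; nlinarith
    have e3 : h * B = h * ∑ n ∈ Finset.Icc 1 ⌊x - h⌋₊, bb k n + h * ∑ n ∈ Finset.Ioc ⌊x - h⌋₊ ⌊x⌋₊, bb k n := by
      rw [hB, s3]; ring
    linarith [w1.1, w2.2]
  have : |h * B| ≤ 5 * C * x ^ 2 + L * h * (h + 1) := abs_le.2 ⟨lo, up⟩
  rw [abs_mul, abs_of_pos hh] at this
  have e : 5 * C * x ^ 2 / h + L * (h + 1) = (5 * C * x ^ 2 + L * h * (h + 1)) / h := by field_simp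
  rw [e, le_div_iff₀ hh]
  linarith

lemma log8 : 2 < Real.log 8 := by
  have : (8:ℝ) = 2 ^ 3 := by norm_num
  rw [this, Real.log_pow]; push_cast; linarith [Real.log_two_gt_d9]

lemma B_bound (m : ℕ) (hm : 1 ≤ m) : ∃ C : ℝ, 0 < C ∧ ∀ x : ℝ, 8 ≤ x →
    |∑ n ∈ Finset.Icc 1 ⌊x⌋₊, bb (2 * m) n| ≤ C * x * Real.log x ^ m := by
  obtain ⟨C, hC, h⟩ := B_aux (2 * m)
  obtain ⟨D, hD, hD2⟩ : ∃ D : ℝ, 0 < D ∧ ∀ x : ℝ, 8 ≤ x → Real.log x ^ m ≤ D * x := by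
    have := (isLittleO_log_rpow_atTop (r := 1) one_pos)
    refine ⟨(m.factorial : ℝ), by positivity, fun x hx => ?_⟩
    have := Real.pow_div_factorial_le_exp (Real.log x) (Real.log_nonneg (by linarith)) m
    rw [Real.exp_log (by linarith), div_le_iff₀ (by positivity)] at this
    linarith
  refine ⟨C + 2 ^ (2 * m) * (1 + D), by positivity, fun x hx => ?_⟩
  have hl : 2 < Real.log x := lt_of_lt_of_le log8 (Real.log_le_log (by norm_num) hx)
  set Lm := Real.log x ^ m with hLm
  have hL2 : 2 ≤ Lm := by
    calc (2:ℝ) = 2 ^ 1 := by norm_num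
      _ ≤ 2 ^ m := pow_le_pow_right₀ (by norm_num) hm
      _ ≤ Lm := pow_le_pow_left₀ (by norm_num) hl.le m
  have hL0 : 0 < Lm := by linarith
  have hx0 : 0 < x := by linarith
  have hh : x / Lm ≤ x / 2 := div_le_div_of_nonneg_left hx0.le (by norm_num) hL2
  have := h x (x / Lm) (by positivity) (by linarith)
  refine this.trans ?_
  have e1 : C * x ^ 2 / (x / Lm) = C * x * Lm := by field_simp
  have e2 : Real.log (2 * x) ^ (2 * m) ≤ 2 ^ (2 * m) * Lm ^ 2 := by
    have : Real.log (2 * x) ≤ 2 * Real.log x := by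
      rw [Real.log_mul (by norm_num) hx0.ne']
      linarith [Real.log_two_lt_d9]
    calc Real.log (2 * x) ^ (2 * m) ≤ (2 * Real.log x) ^ (2 * m) := pow_le_pow_left₀ (Real.log_nonneg (by linarith)) this _
      _ = _ := by rw [hLm]; ring
  have e3 : Lm ^ 2 * (x / Lm + 1) ≤ (1 + D) * x * Lm := by
    have : Lm ^ 2 * (x / Lm + 1) = x * Lm + Lm * Lm := by field_simp
    rw [this]
    nlinarith [hD2 x hx]
  rw [e1]
  have : Real.log (2 * x) ^ (2 * m) * (x / Lm + 1) ≤ 2 ^ (2 * m) * Lm ^ 2 * (x / Lm + 1) := by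
    apply mul_le_mul_of_nonneg_right e2; positivity
  have h5 : 2 ^ (2 * m) * (Lm ^ 2 * (x / Lm + 1)) ≤ 2 ^ (2 * m) * ((1 + D) * x * Lm) := by gcongr
  linarith
end Stmt9

set_option linter.all false
namespace Stmt9
open Filter Topology MeasureTheory

noncomputable def kap (n : ℕ) : ℝ := ArithmeticFunction.vonMangoldt n / Real.log n

noncomputable def KK (x : ℝ) : ℝ := ∑ n ∈ Finset.Icc 1 ⌊x⌋₊, kap n

lemma half_lt_log {u : ℝ} (hu : 2 ≤ u) : 1/2 < Real.log u :=
  lt_of_lt_of_le (by linarith [Real.log_two_gt_d9]) (Real.log_le_log (by norm_num) hu)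

lemma QM (a : ℕ) : ∃ C : ℝ, 0 < C ∧ ∀ u x : ℝ, 2 ≤ u → u ≤ x →
    Real.log x ^ a * Real.sqrt u ≤ C * Real.sqrt x * Real.log u ^ a := by
  refine ⟨4 ^ a * a.factorial * Real.exp (1/4), by positivity, fun u x hu hx => ?_⟩
  have hu0 : 0 < u := by linarith
  have hx0 : 0 < x := by linarith
  have hl := half_lt_log hu
  set v := Real.log x - Real.log u with hv
  have hv0 : 0 ≤ v := by rw [hv]; linarith [Real.log_le_log hu0 hx]
  have h1 : Real.log x ≤ (1 + 2 * v) * Real.log u := by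
    have : v * 1 ≤ v * (2 * Real.log u) := by gcongr; linarith
    nlinarith
  have h2 := Real.pow_div_factorial_le_exp ((1 + 2 * v) / 4) (by positivity) a
  rw [div_le_iff₀ (by positivity)] at h2
  have h3 : (1 + 2 * v) ^ a ≤ 4 ^ a * a.factorial * Real.exp (1/4) * Real.exp (v/2) := by
    have e : (1 + 2 * v) ^ a = 4 ^ a * ((1 + 2 * v)/4) ^ a := by rw [← mul_pow]; congr 1; ring
    have e2 : Real.exp ((1 + 2 * v)/4) = Real.exp (1/4) * Real.exp (v/2) := by rw [← Real.exp_add]; congr 1; ring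
    rw [e]
    rw [e2] at h2
    have := mul_le_mul_of_nonneg_left h2 (show (0:ℝ) ≤ 4 ^ a by positivity)
    linarith
  have h4 : Real.exp (v/2) * Real.sqrt u = Real.sqrt x := by
    rw [Real.sqrt_eq_rpow, Real.sqrt_eq_rpow, Real.rpow_def_of_pos hu0, Real.rpow_def_of_pos hx0, ← Real.exp_add]
    congr 1; rw [hv]; ring
  calc Real.log x ^ a * Real.sqrt u ≤ ((1 + 2 * v) * Real.log u) ^ a * Real.sqrt u := by
        gcongr
        exact Real.log_nonneg (by linarith)
    _ = (1 + 2 * v) ^ a * Real.log u ^ a * Real.sqrt u := by rw [mul_pow]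
    _ ≤ (4 ^ a * a.factorial * Real.exp (1/4) * Real.exp (v/2)) * Real.log u ^ a * Real.sqrt u := by gcongr
    _ = _ := by rw [← h4]; ring

lemma log_pow_le (a : ℕ) : ∃ C : ℝ, 0 < C ∧ ∀ x : ℝ, 2 ≤ x → Real.log x ^ a ≤ C * Real.sqrt x := by
  obtain ⟨C, hC, h⟩ := QM a
  refine ⟨C, hC, fun x hx => ?_⟩
  have := h 2 x le_rfl hx
  have h1 : (1:ℝ) ≤ Real.sqrt 2 := by rw [Real.le_sqrt (by norm_num) (by norm_num)]; norm_num
  have h2 : Real.log 2 ^ a ≤ 1 := pow_le_one₀ (Real.log_nonneg (by norm_num)) (by linarith [Real.log_two_lt_d9])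
  have h3 : 0 ≤ Real.log x ^ a := pow_nonneg (Real.log_nonneg (by linarith)) a
  have h4 : C * Real.sqrt x * Real.log 2 ^ a ≤ C * Real.sqrt x * 1 := by gcongr
  nlinarith

lemma sqrt_le_self' {x : ℝ} (hx : 1 ≤ x) : Real.sqrt x ≤ x := by
  rw [Real.sqrt_le_left (by linarith)]; nlinarith

lemma one_le_div_log (a : ℕ) : ∃ C : ℝ, 0 < C ∧ ∀ x : ℝ, 2 ≤ x → 1 ≤ C * (x / Real.log x ^ a) := by
  obtain ⟨C, hC, h⟩ := log_pow_le a
  refine ⟨C, hC, fun x hx => ?_⟩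
  have hl := half_lt_log hx
  rw [← mul_div_assoc, le_div_iff₀ (by positivity), one_mul]
  refine (h x hx).trans ?_
  gcongr
  exact sqrt_le_self' (by linarith)

lemma cont_inv_log (a : ℕ) : ContinuousOn (fun u : ℝ => (Real.log u ^ a)⁻¹) (Set.Ici 2) := by
  apply ContinuousOn.inv₀
  · apply ContinuousOn.pow
    apply Real.continuousOn_log.mono
    intro u hu
    simp at hu ⊢; linarith
  · intro u hu
    have := half_lt_log (Set.mem_Ici.1 hu)
    positivity

lemma int_inv_log (a : ℕ) {p q : ℝ} (hp : 2 ≤ p) (hq : 2 ≤ q) :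
    IntervalIntegrable (fun u : ℝ => (Real.log u ^ a)⁻¹) volume p q := by
  apply ContinuousOn.intervalIntegrable
  apply (cont_inv_log a).mono
  intro u hu
  rw [Set.mem_uIcc] at hu
  rcases hu with h | h <;> simp <;> linarith

lemma li_bound (a : ℕ) : ∃ C : ℝ, 0 < C ∧ ∀ x : ℝ, 2 ≤ x →
    ∫ u in (2:ℝ)..x, (Real.log u ^ a)⁻¹ ≤ C * (x / Real.log x ^ a) := by
  obtain ⟨C, hC, h⟩ := QM a
  refine ⟨C * 2, by positivity, fun x hx => ?_⟩
  have hx0 : 0 < x := by linarith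
  have hl := half_lt_log hx
  have h1 : ∫ u in (2:ℝ)..x, (Real.log u ^ a)⁻¹ ≤ ∫ u in (2:ℝ)..x, (C * Real.sqrt x / Real.log x ^ a) * u ^ (-(1/2):ℝ) := by
    apply intervalIntegral.integral_mono_on hx (int_inv_log a le_rfl hx)
    · apply IntervalIntegrable.const_mul
      apply intervalIntegral.intervalIntegrable_rpow'
      norm_num
    · intro u hu
      have hu0 : 0 < u := by linarith [hu.1]
      have := h u x hu.1 hu.2
      have hlu := half_lt_log hu.1
      rw [Real.rpow_neg hu0.le, ← Real.sqrt_eq_rpow]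
      have hs : 0 < Real.sqrt u := Real.sqrt_pos.2 hu0
      rw [← div_eq_mul_inv, div_div, inv_eq_one_div, div_le_div_iff₀ (by positivity) (by positivity)]
      linarith
  refine h1.trans ?_
  rw [intervalIntegral.integral_const_mul, integral_rpow (Or.inl (by norm_num))]
  have e : (-(1/2):ℝ) + 1 = 1/2 := by norm_num
  rw [e, ← Real.sqrt_eq_rpow, ← Real.sqrt_eq_rpow]
  have hs : Real.sqrt x * Real.sqrt x = x := Real.mul_self_sqrt hx0.le
  have h2 : (Real.sqrt x - Real.sqrt 2) / (1/2) ≤ 2 * Real.sqrt x := by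
    have := Real.sqrt_nonneg 2
    linarith
  calc C * Real.sqrt x / Real.log x ^ a * ((Real.sqrt x - Real.sqrt 2) / (1/2)) ≤ C * Real.sqrt x / Real.log x ^ a * (2 * Real.sqrt x) := by gcongr
    _ = C * 2 * ((Real.sqrt x * Real.sqrt x) / Real.log x ^ a) := by ring
    _ = _ := by rw [hs]

lemma B_bound2 (m : ℕ) (hm : 1 ≤ m) : ∃ C : ℝ, 0 < C ∧ ∀ x : ℝ, 2 ≤ x →
    |∑ n ∈ Finset.Icc 0 ⌊x⌋₊, bb (2 * m) n| ≤ C * x * Real.log x ^ m := by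
  obtain ⟨C, hC, h⟩ := B_bound m hm
  set c := ∑ n ∈ Finset.Icc 0 8, |bb (2*m) n| with hc
  have hc0 : 0 ≤ c := Finset.sum_nonneg (fun n _ => abs_nonneg _)
  refine ⟨C + c * 2 ^ m, by positivity, fun x hx => ?_⟩
  have hl := half_lt_log hx
  have hx0 : 0 < x := by linarith
  rcases le_or_gt 8 x with h8 | h8
  · have e : ∑ n ∈ Finset.Icc 0 ⌊x⌋₊, bb (2 * m) n = ∑ n ∈ Finset.Icc 1 ⌊x⌋₊, bb (2 * m) n := by
      symm
      apply Finset.sum_subset (Finset.Icc_subset_Icc_left (by norm_num))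
      intro n h1 h2
      have : n = 0 := by
        rw [Finset.mem_Icc] at h1 h2; omega
      subst this
      simp [bb]; omega
    rw [e]
    refine (h x h8).trans ?_
    have : 0 ≤ c * 2 ^ m * x * Real.log x ^ m := by positivity
    nlinarith
  · have h1 : |∑ n ∈ Finset.Icc 0 ⌊x⌋₊, bb (2 * m) n| ≤ c := by
      refine (Finset.abs_sum_le_sum_abs _ _).trans ?_
      apply Finset.sum_le_sum_of_subset_of_nonneg
      · apply Finset.Icc_subset_Icc_right
        have := Nat.floor_le_floor h8.le
        simpa using this
      · intro _ _ _; exact abs_nonneg _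
    refine h1.trans ?_
    have h3 : 1 ≤ 2 ^ m * Real.log x ^ m := by
      rw [← mul_pow]; apply one_le_pow₀; linarith
    have h4 : 1 ≤ x * (2 ^ m * Real.log x ^ m) := by nlinarith
    have h5 : c * 1 ≤ c * (x * (2 ^ m * Real.log x ^ m)) := by gcongr
    have : 0 ≤ C * x * Real.log x ^ m := by positivity
    nlinarith

lemma sum_inv_log {x : ℝ} (hx : 2 ≤ x) :
    |∑ n ∈ Finset.Ioc 2 ⌊x⌋₊, (Real.log n)⁻¹ - ∫ u in (2:ℝ)..x, (Real.log u)⁻¹| ≤ 4 := by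
  have hfl : 2 ≤ ⌊x⌋₊ := Nat.le_floor (by exact_mod_cast hx)
  have hflr : (2:ℝ) ≤ (⌊x⌋₊:ℝ) := by exact_mod_cast hfl
  have hfx : (⌊x⌋₊:ℝ) ≤ x := Nat.floor_le (by linarith)
  have hxf : x < (⌊x⌋₊:ℝ) + 1 := Nat.lt_floor_add_one x
  have hint : ∀ p q : ℝ, 2 ≤ p → 2 ≤ q → IntervalIntegrable (fun u : ℝ => (Real.log u)⁻¹) volume p q := by
    intro p q hp hq
    simpa using int_inv_log 1 hp hq
  have hanti : AntitoneOn (fun u : ℝ => (Real.log u)⁻¹) (Set.Icc ((2:ℕ):ℝ) (⌊x⌋₊:ℝ)) := by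
    intro u hu v hv huv
    have h2 : 2 ≤ u := by exact_mod_cast hu.1
    have := half_lt_log h2
    simp only
    apply inv_anti₀ (by linarith)
    exact Real.log_le_log (by linarith) huv
  have h1 := hanti.sum_le_integral_Ico hfl
  have h2 := hanti.integral_le_sum_Ico hfl
  have e1 : ∑ n ∈ Finset.Ico 2 ⌊x⌋₊, (Real.log ((n+1:ℕ):ℝ))⁻¹ = ∑ n ∈ Finset.Ioc 2 ⌊x⌋₊, (Real.log n)⁻¹ := by
    rw [Finset.sum_Ico_add' (fun n : ℕ => (Real.log (n:ℝ))⁻¹) 2 ⌊x⌋₊ 1]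
    apply Finset.sum_congr _ (fun _ _ => rfl)
    ext n; simp; omega
  have e2 : ∑ n ∈ Finset.Ico 2 ⌊x⌋₊, (Real.log (n:ℝ))⁻¹ ≤ (Real.log 2)⁻¹ + ∑ n ∈ Finset.Ioc 2 ⌊x⌋₊, (Real.log n)⁻¹ := by
    have : Finset.Ico 2 ⌊x⌋₊ ⊆ insert 2 (Finset.Ioc 2 ⌊x⌋₊) := by
      intro n hn; simp at hn ⊢; omega
    refine (Finset.sum_le_sum_of_subset_of_nonneg this ?_).trans ?_
    · intro n _ _; exact inv_nonneg.2 (Real.log_natCast_nonneg n)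
    · rw [Finset.sum_insert (by simp)]; simp
  rw [e1] at h1
  have hl2 : (Real.log 2)⁻¹ ≤ 2 := by
    rw [inv_le_comm₀ (by linarith [half_lt_log (le_refl 2)]) (by norm_num)]
    linarith [half_lt_log (le_refl 2)]
  have e3 := intervalIntegral.integral_add_adjacent_intervals (hint 2 ⌊x⌋₊ le_rfl hflr) (hint ⌊x⌋₊ x hflr hx)
  have e4 : 0 ≤ ∫ u in (⌊x⌋₊:ℝ)..x, (Real.log u)⁻¹ := by
    apply intervalIntegral.integral_nonneg hfx
    intro u hu
    exact inv_nonneg.2 (Real.log_nonneg (by linarith [hu.1]))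
  have e5 : ∫ u in (⌊x⌋₊:ℝ)..x, (Real.log u)⁻¹ ≤ 2 := by
    have : ∫ u in (⌊x⌋₊:ℝ)..x, (Real.log u)⁻¹ ≤ ∫ u in (⌊x⌋₊:ℝ)..x, (2:ℝ) := by
      apply intervalIntegral.integral_mono_on hfx (hint _ _ hflr hx) (by simp)
      intro u hu
      have := half_lt_log (show 2 ≤ u by linarith [hu.1])
      rw [inv_le_comm₀ (by linarith) (by norm_num)]; linarith
    rw [intervalIntegral.integral_const, smul_eq_mul] at this
    linarith
  push_cast at h1 h2
  rw [abs_le]; constructor <;> linarith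

lemma abel_bound (m : ℕ) (hm : 1 ≤ m) : ∃ C : ℝ, 0 < C ∧ ∀ x : ℝ, 2 ≤ x →
    |∑ n ∈ Finset.Ioc 2 ⌊x⌋₊, (kap n - (Real.log n)⁻¹)| ≤ C * (x / Real.log x ^ (m+1)) := by
  obtain ⟨C, hC, hB⟩ := B_bound2 m hm
  obtain ⟨C1, hC1, hli⟩ := li_bound (m+2)
  obtain ⟨C2, hC2, h1⟩ := one_le_div_log (m+1)
  set f : ℝ → ℝ := fun u => (Real.log u ^ (2*m+1))⁻¹ with hf
  set S : ℝ → ℝ := fun t => ∑ n ∈ Finset.Icc 0 ⌊t⌋₊, bb (2*m) n with hS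
  set c0 := |f 2 * S 2| with hc0
  have hc00 : 0 ≤ c0 := abs_nonneg _
  have hder : ∀ u : ℝ, 2 ≤ u → HasDerivAt f (-((2*m+1) * (Real.log u ^ (2*m+2))⁻¹ * u⁻¹)) u := by
    intro u hu
    have hl := half_lt_log hu
    have hne : (Real.log ^ (2*m+1)) u ≠ 0 := by rw [Pi.pow_apply]; positivity
    have h := ((Real.hasDerivAt_log (show u ≠ 0 by linarith)).pow (2*m+1)).inv hne
    refine h.congr_deriv ?_
    have : u ≠ 0 := by linarith
    have : Real.log u ≠ 0 := by linarith
    field_simp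
    push_cast
    simp only [Nat.add_sub_cancel, Pi.pow_apply]
    ring
  refine ⟨C + c0 * C2 + (2*m+1) * C * (C1 * 2), by positivity, fun x hx => ?_⟩
  have hl := half_lt_log hx
  have hcd : ContinuousOn (fun u : ℝ => -((2*m+1) * (Real.log u ^ (2*m+2))⁻¹ * u⁻¹)) (Set.Icc 2 x) := by
    apply ContinuousOn.neg
    apply ContinuousOn.mul
    · apply ContinuousOn.mul continuousOn_const
      exact (cont_inv_log (2*m+2)).mono (fun u hu => hu.1)
    · apply ContinuousOn.inv₀ continuousOn_id
      intro u hu; simp; linarith [hu.1]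
  have hdi : IntegrableOn (deriv f) (Set.Icc 2 x) := by
    apply (hcd.congr _).integrableOn_Icc
    intro u hu
    exact (hder u hu.1).deriv
  have hab := sum_mul_eq_sub_sub_integral_mul (bb (2*m)) (f := f) (a := 2) (b := x) (by norm_num) hx
    (fun t ht => (hder t ht.1).differentiableAt) hdi
  have e1 : ∑ k ∈ Finset.Ioc ⌊(2:ℝ)⌋₊ ⌊x⌋₊, f k * bb (2*m) k = ∑ n ∈ Finset.Ioc 2 ⌊x⌋₊, (kap n - (Real.log n)⁻¹) := by
    have : ⌊(2:ℝ)⌋₊ = 2 := by norm_num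
    rw [this]
    refine Finset.sum_congr rfl (fun n hn => ?_)
    rw [Finset.mem_Ioc] at hn
    have h2 : (2:ℝ) ≤ n := by exact_mod_cast hn.1.le
    have := half_lt_log h2
    simp only [hf, bb, kap]
    have : Real.log n ≠ 0 := by linarith
    field_simp
    ring
  rw [← e1, hab]
  have t1 : |f x * S x| ≤ C * (x / Real.log x ^ (m+1)) := by
    rw [abs_mul]
    have : |f x| = (Real.log x ^ (2*m+1))⁻¹ := abs_of_nonneg (by positivity)
    rw [this]
    calc _ ≤ (Real.log x ^ (2*m+1))⁻¹ * (C * x * Real.log x ^ m) := by gcongr; exact hB x hx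
      _ = _ := by field_simp; ring
  have t2 : c0 ≤ c0 * C2 * (x / Real.log x ^ (m+1)) := by
    have := mul_le_mul_of_nonneg_left (h1 x hx) hc00
    linarith
  have t3 : |∫ t in Set.Ioc 2 x, deriv f t * S t| ≤ (2*m+1) * C * (C1 * 2) * (x / Real.log x ^ (m+1)) := by
    have hx0 : 0 < x := by linarith
    have a1 : |∫ t in Set.Ioc 2 x, deriv f t * S t| ≤ ∫ t in Set.Ioc 2 x, (2*m+1) * C * (Real.log t ^ (m+2))⁻¹ := by
      rw [← Real.norm_eq_abs]
      apply norm_integral_le_of_norm_le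
      · have := (int_inv_log (m+2) le_rfl hx)
        rw [intervalIntegrable_iff_integrableOn_Ioc_of_le hx] at this
        exact this.const_mul _
      · rw [ae_restrict_iff' measurableSet_Ioc]
        refine Eventually.of_forall (fun t ht => ?_)
        have ht2 : 2 ≤ t := ht.1.le
        have hlt := half_lt_log ht2
        have ht0 : 0 < t := by linarith
        rw [(hder t ht2).deriv, norm_mul, norm_neg, Real.norm_of_nonneg (by positivity), Real.norm_eq_abs]
        calc _ ≤ ((2*m+1) * (Real.log t ^ (2*m+2))⁻¹ * t⁻¹) * (C * t * Real.log t ^ m) := by gcongr; exact hB t ht2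
          _ = _ := by field_simp; ring
    refine a1.trans ?_
    rw [integral_const_mul, ← intervalIntegral.integral_of_le hx]
    have a2 := hli x hx
    have a3 : x / Real.log x ^ (m+2) ≤ 2 * (x / Real.log x ^ (m+1)) := by
      rw [pow_succ (Real.log x) (m+1), ← div_div, div_le_iff₀ (by linarith)]
      have : 0 ≤ x / Real.log x ^ (m+1) := by positivity
      nlinarith
    calc _ ≤ (2*m+1) * C * (C1 * (x / Real.log x ^ (m+2))) := by gcongr
      _ ≤ (2*m+1) * C * (C1 * (2 * (x / Real.log x ^ (m+1)))) := by gcongr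
      _ = _ := by ring
  have := abs_sub (f x * S x - f 2 * S 2) (∫ t in Set.Ioc 2 x, deriv f t * S t)
  have := abs_sub (f x * S x) (f 2 * S 2)
  change |f x * S x - f 2 * S 2 - ∫ t in Set.Ioc 2 x, deriv f t * S t| ≤ _
  rw [add_mul, add_mul]
  linarith

theorem PNT (A : ℕ) (hA : 2 ≤ A) : ∃ C : ℝ, 0 < C ∧ ∀ x : ℝ, 2 ≤ x →
    |KK x - ∫ u in (2:ℝ)..x, (Real.log u)⁻¹| ≤ C * (x / Real.log x ^ A) := by
  obtain ⟨m, rfl⟩ : ∃ m, A = m + 1 := ⟨A - 1, by omega⟩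
  obtain ⟨C, hC, h⟩ := abel_bound m (by omega)
  obtain ⟨C2, hC2, h1⟩ := one_le_div_log (m+1)
  set c := |∑ n ∈ Finset.Icc 1 2, kap n| + 4 with hc
  refine ⟨C + c * C2, by positivity, fun x hx => ?_⟩
  have hfl : 2 ≤ ⌊x⌋₊ := Nat.le_floor (by exact_mod_cast hx)
  have e1 := sum_split kap hfl
  have e2 := h x hx
  rw [Finset.sum_sub_distrib] at e2
  have e3 := sum_inv_log hx
  have e4 := h1 x hx
  rw [KK, e1]
  have hc0 : 0 ≤ c := by positivity
  have e5 := mul_le_mul_of_nonneg_left e4 hc0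
  have e6 := abs_add_le (∑ n ∈ Finset.Icc 1 2, kap n) (∑ n ∈ Finset.Ioc 2 ⌊x⌋₊, kap n - ∑ n ∈ Finset.Ioc 2 ⌊x⌋₊, (Real.log n)⁻¹)
  have e7 := abs_add_le (∑ n ∈ Finset.Icc 1 2, kap n + (∑ n ∈ Finset.Ioc 2 ⌊x⌋₊, kap n - ∑ n ∈ Finset.Ioc 2 ⌊x⌋₊, (Real.log n)⁻¹)) (∑ n ∈ Finset.Ioc 2 ⌊x⌋₊, (Real.log n)⁻¹ - ∫ u in (2:ℝ)..x, (Real.log u)⁻¹)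
  have e8 : ∑ n ∈ Finset.Icc 1 2, kap n + ∑ n ∈ Finset.Ioc 2 ⌊x⌋₊, kap n - ∫ u in (2:ℝ)..x, (Real.log u)⁻¹ = (∑ n ∈ Finset.Icc 1 2, kap n + (∑ n ∈ Finset.Ioc 2 ⌊x⌋₊, kap n - ∑ n ∈ Finset.Ioc 2 ⌊x⌋₊, (Real.log n)⁻¹)) + (∑ n ∈ Finset.Ioc 2 ⌊x⌋₊, (Real.log n)⁻¹ - ∫ u in (2:ℝ)..x, (Real.log u)⁻¹) := by ring
  rw [e8]
  linarith
end Stmt9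

set_option linter.all false
namespace Stmt9
open Filter Topology MeasureTheory

noncomputable def RR (x : ℝ) : ℝ := ∑ n ∈ Finset.Icc 1 ⌊x⌋₊, kap n / n

noncomputable def li (x : ℝ) : ℝ := ∫ u in (2:ℝ)..x, (Real.log u)⁻¹

noncomputable def DD (x : ℝ) : ℝ := KK x - li x

lemma li_deriv {x : ℝ} (hx : 2 ≤ x) : HasDerivWithinAt li ((Real.log x)⁻¹) (Set.Ici x) x := by
  have hc : ContinuousOn (fun u : ℝ => (Real.log u)⁻¹) (Set.Ioi 1) := by
    apply ContinuousOn.inv₀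
    · exact Real.continuousOn_log.mono (fun u hu => by simp at hu ⊢; linarith)
    · intro u hu; exact (Real.log_pos hu).ne'
  have := intervalIntegral.integral_hasDerivAt_right (f := fun u : ℝ => (Real.log u)⁻¹) (a := 2) (b := x)
    (by simpa using int_inv_log 1 le_rfl hx)
    (hc.stronglyMeasurableAtFilter isOpen_Ioi x (by simp; linarith))
    (hc.continuousAt (isOpen_Ioi.mem_nhds (by simp; linarith)))
  exact this.hasDerivWithinAt

lemma li_deriv' {x : ℝ} (hx : 2 ≤ x) : HasDerivAt li ((Real.log x)⁻¹) x := by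
  have hc : ContinuousOn (fun u : ℝ => (Real.log u)⁻¹) (Set.Ioi 1) := by
    apply ContinuousOn.inv₀
    · exact Real.continuousOn_log.mono (fun u hu => by simp at hu ⊢; linarith)
    · intro u hu; exact (Real.log_pos hu).ne'
  exact intervalIntegral.integral_hasDerivAt_right (f := fun u : ℝ => (Real.log u)⁻¹) (a := 2) (b := x)
    (by simpa using int_inv_log 1 le_rfl hx)
    (hc.stronglyMeasurableAtFilter isOpen_Ioi x (by simp; linarith))
    (hc.continuousAt (isOpen_Ioi.mem_nhds (by simp; linarith)))

lemma kap_nonneg (n : ℕ) : 0 ≤ kap n :=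
  div_nonneg ArithmeticFunction.vonMangoldt_nonneg (Real.log_natCast_nonneg n)

lemma kap_le (n : ℕ) : kap n ≤ 1 := by
  unfold kap
  exact div_le_one_of_le₀ ArithmeticFunction.vonMangoldt_le_log (Real.log_natCast_nonneg n)

lemma kap_zero : kap 0 = 0 := by simp [kap]
lemma kap_one : kap 1 = 0 := by simp [kap]

lemma sum_Icc_zero (f : ℕ → ℝ) (h : f 0 = 0) (N : ℕ) :
    ∑ n ∈ Finset.Icc 0 N, f n = ∑ n ∈ Finset.Icc 1 N, f n := by
  symm
  apply Finset.sum_subset (Finset.Icc_subset_Icc_left (by norm_num))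
  intro n h1 h2
  have : n = 0 := by rw [Finset.mem_Icc] at h1 h2; omega
  rw [this, h]

lemma KK_mono : Monotone KK := by
  intro x y h
  apply Finset.sum_le_sum_of_subset_of_nonneg
  · exact Finset.Icc_subset_Icc_right (Nat.floor_le_floor h)
  · intro n _ _; exact kap_nonneg n

lemma RR_mono : Monotone RR := by
  intro x y h
  apply Finset.sum_le_sum_of_subset_of_nonneg
  · exact Finset.Icc_subset_Icc_right (Nat.floor_le_floor h)
  · intro n _ _; exact div_nonneg (kap_nonneg n) (by positivity)

lemma KK_int (p q : ℝ) (hp : 2 ≤ p) (hq : 2 ≤ q) : IntervalIntegrable (fun u => KK u / u ^ 2) volume p q := by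
  simp_rw [div_eq_mul_inv]
  apply IntervalIntegrable.mul_continuousOn KK_mono.intervalIntegrable
  apply ContinuousOn.inv₀ (by fun_prop)
  intro u hu
  rw [Set.mem_uIcc] at hu
  have : 0 < u := by rcases hu with h | h <;> linarith
  positivity

lemma RR_abel {y : ℝ} (hy : 2 ≤ y) : RR y = KK y / y + ∫ u in (2:ℝ)..y, KK u / u ^ 2 := by
  have hfl : 2 ≤ ⌊y⌋₊ := Nat.le_floor (by exact_mod_cast hy)
  have h2 : ⌊(2:ℝ)⌋₊ = 2 := by norm_num
  have hder : ∀ u : ℝ, 2 ≤ u → HasDerivAt (fun u : ℝ => u⁻¹) (-(u^2)⁻¹) u := fun u hu => hasDerivAt_inv (by linarith)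
  have hdi : IntegrableOn (deriv (fun u : ℝ => u⁻¹)) (Set.Icc 2 y) := by
    have hcd : ContinuousOn (fun u : ℝ => -(u^2)⁻¹) (Set.Icc 2 y) := by
      apply ContinuousOn.neg
      apply ContinuousOn.inv₀ (by fun_prop)
      intro u hu
      have : 0 < u := by linarith [hu.1]
      positivity
    apply (hcd.congr _).integrableOn_Icc
    intro u hu
    exact (hder u hu.1).deriv
  have hab := sum_mul_eq_sub_sub_integral_mul kap (f := fun u => u⁻¹) (a := 2) (b := y) (by norm_num) hy
    (fun t ht => (hder t ht.1).differentiableAt) hdi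
  simp_rw [sum_Icc_zero kap kap_zero] at hab
  rw [h2] at hab
  have e := sum_split (fun n => kap n / n) hfl
  have e2 : ∑ n ∈ Finset.Icc 1 2, kap n / (n:ℝ) = (2:ℝ)⁻¹ * ∑ n ∈ Finset.Icc 1 2, kap n := by
    have : Finset.Icc 1 2 = {1, 2} := by decide
    rw [this]; simp [kap_one]; ring
  have e3 : ∫ t in Set.Ioc 2 y, deriv (fun u : ℝ => u⁻¹) t * ∑ k ∈ Finset.Icc 1 ⌊t⌋₊, kap k = -∫ u in (2:ℝ)..y, KK u / u ^ 2 := by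
    rw [intervalIntegral.integral_of_le hy, ← integral_neg]
    apply setIntegral_congr_fun measurableSet_Ioc
    intro t ht
    simp only
    rw [(hder t ht.1.le).deriv, KK]; ring
  rw [e3] at hab
  have e4 : ∑ k ∈ Finset.Ioc 2 ⌊y⌋₊, ((k:ℕ):ℝ)⁻¹ * kap k = ∑ n ∈ Finset.Ioc 2 ⌊y⌋₊, kap n / n :=
    Finset.sum_congr rfl (fun n _ => by ring)
  rw [e4] at hab
  rw [RR, e, e2, hab, KK]; ring

lemma li_int (p q : ℝ) (hp : 2 ≤ p) (hq : 2 ≤ q) : IntervalIntegrable (fun u => li u / u ^ 2) volume p q := by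
  apply ContinuousOn.intervalIntegrable
  have hu : ∀ u ∈ Set.uIcc p q, 2 ≤ u := by
    intro u hu
    rw [Set.mem_uIcc] at hu
    rcases hu with h | h <;> linarith
  apply ContinuousOn.div
  · intro u h; exact (li_deriv' (hu u h)).continuousAt.continuousWithinAt
  · fun_prop
  · intro u h
    have : 0 < u := by linarith [hu u h]
    positivity

lemma li_parts {y : ℝ} (hy : 2 ≤ y) : li y / y + ∫ u in (2:ℝ)..y, li u / u ^ 2 =
    Real.log (Real.log y) - Real.log (Real.log 2) := by
  have hu : ∀ u ∈ Set.uIcc 2 y, 2 ≤ u := by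
    intro u hu
    rw [Set.mem_uIcc] at hu
    rcases hu with h | h <;> linarith
  have hd : ∀ u ∈ Set.uIcc 2 y, HasDerivAt (fun u => Real.log (Real.log u) - li u / u) (li u / u ^ 2) u := by
    intro u h
    have h2 := hu u h
    have hl := half_lt_log h2
    have hu0 : u ≠ 0 := by linarith
    have h1 := (Real.hasDerivAt_log hu0).log (by linarith)
    have h3 := (li_deriv' h2).div (hasDerivAt_id u) hu0
    refine (h1.sub h3).congr_deriv ?_
    simp only [id]
    have : Real.log u ≠ 0 := by linarith
    field_simp
    ring
  rw [intervalIntegral.integral_eq_sub_of_hasDerivAt hd (li_int 2 y le_rfl hy)]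
  have : li 2 = 0 := by simp [li]
  rw [this]; ring

lemma DD_int (p q : ℝ) (hp : 2 ≤ p) (hq : 2 ≤ q) : IntervalIntegrable (fun u => DD u / u ^ 2) volume p q := by
  have := (KK_int p q hp hq).sub (li_int p q hp hq)
  refine this.congr ?_
  intro u _
  simp [DD]; ring

lemma RR_eq {y : ℝ} (hy : 2 ≤ y) : RR y = Real.log (Real.log y) - Real.log (Real.log 2) + DD y / y + ∫ u in (2:ℝ)..y, DD u / u ^ 2 := by
  have e : ∫ u in (2:ℝ)..y, DD u / u ^ 2 = (∫ u in (2:ℝ)..y, KK u / u ^ 2) - ∫ u in (2:ℝ)..y, li u / u ^ 2 := by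
    rw [← intervalIntegral.integral_sub (KK_int 2 y le_rfl hy) (li_int 2 y le_rfl hy)]
    apply intervalIntegral.integral_congr
    intro u _
    simp [DD]; ring
  rw [RR_abel hy, e, ← li_parts hy, DD]; ring

/-- integrability and value of `1/(u log^a u)` -/
lemma inv_log_Ioi (a : ℕ) (ha : 1 ≤ a) {y : ℝ} (hy : 2 ≤ y) :
    IntegrableOn (fun u : ℝ => u⁻¹ * (Real.log u ^ (a+1))⁻¹) (Set.Ioi y) ∧
    ∫ u in Set.Ioi y, u⁻¹ * (Real.log u ^ (a+1))⁻¹ = (a:ℝ)⁻¹ * (Real.log y ^ a)⁻¹ := by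
  have hd : ∀ u ∈ Set.Ici y, HasDerivAt (fun u : ℝ => -((a:ℝ)⁻¹ * (Real.log u ^ a)⁻¹)) (u⁻¹ * (Real.log u ^ (a+1))⁻¹) u := by
    intro u h
    have h2 : 2 ≤ u := le_trans hy h
    have hl := half_lt_log h2
    have hu0 : u ≠ 0 := by linarith
    have hne : (Real.log ^ a) u ≠ 0 := by rw [Pi.pow_apply]; positivity
    have h3 := ((((Real.hasDerivAt_log hu0).pow a).inv hne).const_mul (a:ℝ)⁻¹).neg
    refine h3.congr_deriv ?_
    have : Real.log u ≠ 0 := by linarith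
    have ha' : (a:ℝ) ≠ 0 := by positivity
    simp only [Pi.pow_apply]
    obtain ⟨b, rfl⟩ : ∃ b, a = b + 1 := ⟨a - 1, by omega⟩
    simp only [Nat.add_sub_cancel]
    field_simp
    ring
  have hpos : ∀ u ∈ Set.Ioi y, 0 ≤ u⁻¹ * (Real.log u ^ (a+1))⁻¹ := by
    intro u h
    have h2 : 2 ≤ u := le_trans hy (le_of_lt h)
    have hl := half_lt_log h2
    have hu0 : 0 < u := by linarith
    positivity
  have ht : Tendsto (fun u : ℝ => -((a:ℝ)⁻¹ * (Real.log u ^ a)⁻¹)) atTop (𝓝 0) := by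
    have h1 : Tendsto (fun u : ℝ => Real.log u ^ a) atTop atTop :=
      (tendsto_pow_atTop (by omega)).comp Real.tendsto_log_atTop
    have := (h1.inv_tendsto_atTop.const_mul (a:ℝ)⁻¹).neg
    simpa using this
  have hi := integrableOn_Ioi_deriv_of_nonneg' hd hpos ht
  refine ⟨hi, ?_⟩
  rw [integral_Ioi_of_hasDerivAt_of_tendsto' hd hi ht]; ring

lemma DD_bound (A : ℕ) (hA : 1 ≤ A) : ∃ C : ℝ, 0 < C ∧ ∀ x : ℝ, 2 ≤ x → |DD x| ≤ C * (x / Real.log x ^ (A+1)) := by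
  exact PNT (A+1) (by omega)

noncomputable def MM : ℝ := - Real.log (Real.log 2) + ∫ u in Set.Ioi (2:ℝ), DD u / u ^ 2

lemma mertens0 (A : ℕ) (hA : 1 ≤ A) : ∃ C : ℝ, 0 < C ∧ ∀ y : ℝ, 2 ≤ y →
    |RR y - (Real.log (Real.log y) + MM)| ≤ C / Real.log y ^ A := by
  obtain ⟨C, hC, h⟩ := DD_bound A hA
  refine ⟨C * 2 + C * (A:ℝ)⁻¹, by positivity, fun y hy => ?_⟩
  have hl := half_lt_log hy
  have hb : ∀ u : ℝ, 2 ≤ u → ‖DD u / u ^ 2‖ ≤ C * (u⁻¹ * (Real.log u ^ (A+1))⁻¹) := by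
    intro u hu
    have hu0 : 0 < u := by linarith
    have := h u hu
    have hl := half_lt_log hu
    rw [norm_div, Real.norm_eq_abs, Real.norm_of_nonneg (by positivity), div_le_iff₀ (by positivity)]
    refine this.trans (le_of_eq ?_)
    field_simp
  have hmeas : AEStronglyMeasurable (fun u => DD u / u ^ 2) (volume.restrict (Set.Ioi 2)) := by
    have h1 : Measurable KK := KK_mono.measurable
    have h2 : AEStronglyMeasurable li (volume.restrict (Set.Ioi 2)) := by
      apply ContinuousOn.aestronglyMeasurable _ measurableSet_Ioi
      intro u hu
      exact (li_deriv' (le_of_lt hu)).continuousAt.continuousWithinAt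
    have h3 : AEMeasurable DD (volume.restrict (Set.Ioi 2)) := h1.aemeasurable.sub h2.aemeasurable
    exact (h3.div (by fun_prop)).aestronglyMeasurable
  have hint : IntegrableOn (fun u => DD u / u ^ 2) (Set.Ioi 2) := by
    refine Integrable.mono' ((inv_log_Ioi A hA le_rfl).1.const_mul C) hmeas ?_
    rw [ae_restrict_iff' measurableSet_Ioi]
    exact Eventually.of_forall (fun u hu => hb u (le_of_lt hu))
  have hs : ∫ u in Set.Ioi (2:ℝ), DD u / u ^ 2 = (∫ u in (2:ℝ)..y, DD u / u ^ 2) + ∫ u in Set.Ioi y, DD u / u ^ 2 := by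
    rw [← intervalIntegral.integral_interval_add_Ioi hint (hint.mono_set (Set.Ioi_subset_Ioi hy))]
  have ht : |∫ u in Set.Ioi y, DD u / u ^ 2| ≤ C * (A:ℝ)⁻¹ * (Real.log y ^ A)⁻¹ := by
    obtain ⟨i1, i2⟩ := inv_log_Ioi A hA hy
    rw [mul_assoc, ← i2, ← integral_const_mul, ← Real.norm_eq_abs]
    apply norm_integral_le_of_norm_le (i1.const_mul C)
    rw [ae_restrict_iff' measurableSet_Ioi]
    exact Eventually.of_forall (fun u hu => hb u (le_trans hy (le_of_lt hu)))
  have hD : |DD y / y| ≤ C * 2 * (Real.log y ^ A)⁻¹ := by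
    have hy0 : 0 < y := by linarith
    rw [abs_div, abs_of_pos hy0, div_le_iff₀ hy0]
    refine (h y hy).trans ?_
    have : (Real.log y)⁻¹ ≤ 2 := by rw [inv_le_comm₀ (by linarith) (by norm_num)]; linarith
    calc C * (y / Real.log y ^ (A+1)) = C * (Real.log y)⁻¹ * (Real.log y ^ A)⁻¹ * y := by rw [pow_succ]; field_simp
      _ ≤ C * 2 * (Real.log y ^ A)⁻¹ * y := by gcongr
  have e : RR y - (Real.log (Real.log y) + MM) = DD y / y - ∫ u in Set.Ioi y, DD u / u ^ 2 := by
    rw [RR_eq hy, MM, hs]; ring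
  rw [e, div_eq_mul_inv (C * 2 + _), add_mul]
  exact (abs_sub _ _).trans (add_le_add hD ht)
end Stmt9

set_option linter.all false
namespace Stmt9
open Filter Topology MeasureTheory

lemma int_log_exp : ∫ t in Set.Ioi (0:ℝ), Real.log t * Real.exp (-t) = -Real.eulerMascheroniConstant := by
  have h1 := Complex.hasDerivAt_GammaIntegral (s := 1) (by simp)
  have h2 := Complex.hasDerivAt_Gamma_one
  have h3 : Complex.GammaIntegral =ᶠ[𝓝 1] Complex.Gamma := by
    have : {z : ℂ | 0 < z.re} ∈ 𝓝 (1:ℂ) := (isOpen_lt continuous_const Complex.continuous_re).mem_nhds (by simp)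
    filter_upwards [this] with z hz using (Complex.Gamma_eq_integral hz).symm
  have h4 := (h1.congr_of_eventuallyEq h3.symm).unique h2
  have h5 : ∫ t in Set.Ioi (0:ℝ), (t:ℂ) ^ ((1:ℂ) - 1) * (Real.log t * Real.exp (-t)) = ((∫ t in Set.Ioi (0:ℝ), Real.log t * Real.exp (-t) : ℝ) : ℂ) := by
    rw [← integral_complex_ofReal]
    apply setIntegral_congr_fun measurableSet_Ioi
    intro t ht
    simp
  rw [h5] at h4
  exact_mod_cast h4

lemma integrable_log_exp : IntegrableOn (fun t => Real.log t * Real.exp (-t)) (Set.Ioi (0:ℝ)) := by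
  by_contra h
  have := integral_undef h
  rw [int_log_exp] at this
  linarith [Real.one_half_lt_eulerMascheroniConstant]

lemma int_exp_scaled {d : ℝ} (hd : 0 < d) : IntegrableOn (fun w => Real.exp (-(d * w))) (Set.Ioi (0:ℝ)) ∧
    d * ∫ w in Set.Ioi (0:ℝ), Real.exp (-(d * w)) = 1 := by
  have h := integral_exp_neg_Ioi_zero
  have h1 := integral_comp_mul_left_Ioi (fun v => Real.exp (-v)) 0 hd
  have h2 := integrableOn_Ioi_comp_mul_left_iff (fun v => Real.exp (-v)) 0 hd
  rw [mul_zero] at h1 h2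
  refine ⟨h2.2 (integrableOn_exp_neg_Ioi 0), ?_⟩
  rw [h1, h]; simp; field_simp

lemma int_log_scaled {d : ℝ} (hd : 0 < d) : IntegrableOn (fun w => Real.log w * Real.exp (-(d * w))) (Set.Ioi (0:ℝ)) ∧
    d * ∫ w in Set.Ioi (0:ℝ), Real.log w * Real.exp (-(d * w)) = -Real.eulerMascheroniConstant - Real.log d := by
  have h1 := integral_comp_mul_left_Ioi (fun v => Real.log v * Real.exp (-v)) 0 hd
  have h2 := integrableOn_Ioi_comp_mul_left_iff (fun v => Real.log v * Real.exp (-v)) 0 hd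
  rw [mul_zero] at h1 h2
  obtain ⟨i1, i2⟩ := int_exp_scaled hd
  have h3 := h2.2 integrable_log_exp
  have e : Set.EqOn (fun w => Real.log (d * w) * Real.exp (-(d * w)) - Real.log d * Real.exp (-(d * w)))
      (fun w => Real.log w * Real.exp (-(d * w))) (Set.Ioi 0) := by
    intro w hw
    have : w ≠ 0 := ne_of_gt hw
    simp only
    rw [Real.log_mul hd.ne' this]; ring
  have h4 := h3.sub (i1.const_mul (Real.log d))
  refine ⟨(integrableOn_congr_fun e measurableSet_Ioi).1 h4, ?_⟩
  rw [← setIntegral_congr_fun measurableSet_Ioi e, integral_sub h3 (i1.const_mul _), h1, int_log_exp, integral_const_mul,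
    mul_sub, smul_eq_mul]
  have : d * (Real.log d * ∫ w in Set.Ioi (0:ℝ), Real.exp (-(d * w))) = Real.log d * (d * ∫ w in Set.Ioi (0:ℝ), Real.exp (-(d * w))) := by ring
  rw [this, i2]; field_simp

noncomputable def Fk (s : ℂ) : ℂ := LSeries (fun n => (kap n : ℂ)) s

lemma kap_abs : LSeries.abscissaOfAbsConv (fun n => (kap n : ℂ)) ≤ 1 := by
  apply LSeries.abscissaOfAbsConv_le_one_of_isBigO_one
  apply Asymptotics.isBigO_of_le
  intro n
  rw [Complex.norm_real, Real.norm_of_nonneg (kap_nonneg n)]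
  simpa using kap_le n

lemma kap_abs_lt {s : ℂ} (hs : 1 < s.re) : LSeries.abscissaOfAbsConv (fun n => (kap n : ℂ)) < s.re :=
  lt_of_le_of_lt kap_abs (by exact_mod_cast hs)

lemma Fk_deriv {s : ℂ} (hs : 1 < s.re) : HasDerivAt Fk (deriv riemannZeta s / riemannZeta s) s := by
  have h := LSeries_hasDerivAt (kap_abs_lt hs)
  have e : LSeries.logMul (fun n => (kap n : ℂ)) = (fun n => (ArithmeticFunction.vonMangoldt n : ℂ)) := by
    ext n
    simp only [LSeries.logMul]
    rcases Nat.lt_or_ge n 2 with h | h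
    · interval_cases n <;> simp [kap]
    · have := half_lt_log (show (2:ℝ) ≤ n by exact_mod_cast h)
      rw [Complex.natCast_log.symm, ← Complex.ofReal_mul, kap]
      congr 1
      field_simp
  rw [e, ArithmeticFunction.LSeries_vonMangoldt_eq_deriv_riemannZeta_div hs] at h
  refine h.congr_deriv ?_
  ring

lemma exp_Fk {s : ℂ} (hs : 1 < s.re) : Complex.exp (Fk s) = riemannZeta s := by
  set U : Set ℂ := {z : ℂ | 1 < z.re} with hU
  have hUo : IsOpen U := isOpen_lt continuous_const Complex.continuous_re
  have hUc : IsPreconnected U := (convex_halfSpace_re_gt 1).isPreconnected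
  set H : ℂ → ℂ := fun s => riemannZeta s * Complex.exp (-Fk s) with hH
  have hd : ∀ z ∈ U, HasDerivAt H 0 z := by
    intro z hz
    have hz1 : z ≠ 1 := by rintro rfl; simp [hU] at hz
    have h1 := (differentiableAt_riemannZeta hz1).hasDerivAt
    have h2 := ((Fk_deriv hz).neg).cexp
    refine (h1.mul h2).congr_deriv ?_
    have := riemannZeta_ne_zero_of_one_lt_re hz
    simp only [Pi.neg_apply]
    field_simp
    ring
  obtain ⟨a, ha⟩ := hUo.exists_is_const_of_deriv_eq_zero hUc
    (fun z hz => (hd z hz).differentiableAt.differentiableWithinAt) (fun z hz => (hd z hz).deriv)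
  have t1 : Tendsto (fun x : ℝ => Fk x) atTop (𝓝 0) := by
    have := LSeries.tendsto_atTop (f := fun n => (kap n : ℂ)) (lt_of_le_of_lt kap_abs (EReal.coe_lt_top 1))
    simpa [kap_one, Fk] using this
  have t2 : Tendsto (fun x : ℝ => riemannZeta x) atTop (𝓝 1) := by
    have := LSeries.tendsto_atTop (f := 1) (by rw [LSeries.abscissaOfAbsConv_one]; exact EReal.coe_lt_top 1)
    simp only [Pi.one_apply] at this
    refine this.congr' ?_
    filter_upwards [eventually_gt_atTop 1] with x hx
    exact LSeries_one_eq_riemannZeta (by simpa using hx)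
  have t3 : Tendsto (fun x : ℝ => H x) atTop (𝓝 1) := by
    have := t2.mul t1.neg.cexp
    simpa using this
  have t4 : Tendsto (fun x : ℝ => H x) atTop (𝓝 a) := by
    refine tendsto_const_nhds.congr' ?_
    filter_upwards [eventually_gt_atTop 1] with x hx
    exact (ha _ (by simpa [hU] using hx)).symm
  have ha1 := tendsto_nhds_unique t4 t3
  have := ha s hs
  rw [ha1] at this
  simp only [hH, Complex.exp_neg] at this
  have h0 := Complex.exp_ne_zero (Fk s)
  field_simp at this
  exact this.symm

lemma Fk_integral {d : ℝ} (hd : 0 < d) :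
    Fk (((1 + d : ℝ)) : ℂ) = ((d * ∫ w in Set.Ioi (0:ℝ), RR (Real.exp w) * Real.exp (-(d * w)) : ℝ) : ℂ) := by
  have e1 : Fk (((1 + d : ℝ)) : ℂ) = LSeries (fun n => ((kap n / n : ℝ) : ℂ)) (d : ℂ) := by
    unfold Fk LSeries
    congr 1; ext n
    rcases eq_or_ne n 0 with rfl | hn
    · simp
    · rw [LSeries.term_of_ne_zero hn, LSeries.term_of_ne_zero hn]
      have : (n:ℂ) ≠ 0 := by exact_mod_cast hn
      push_cast
      rw [Complex.cpow_add _ _ this, Complex.cpow_one, div_div]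
  have hO : (fun n : ℕ => ∑ k ∈ Finset.Icc 1 n, kap k / (k:ℝ)) =O[atTop] fun n : ℕ => (n : ℝ) ^ (d/2) := by
    have h1 : (fun n : ℕ => ∑ k ∈ Finset.Icc 1 n, kap k / (k:ℝ)) =O[atTop] fun n : ℕ => (1 + Real.log n) := by
      apply Asymptotics.isBigO_of_le
      intro n
      rw [Real.norm_of_nonneg (Finset.sum_nonneg (fun k _ => div_nonneg (kap_nonneg k) (by positivity))),
        Real.norm_of_nonneg (by have := Real.log_natCast_nonneg n; positivity)]
      refine le_trans ?_ (harmonic_le_one_add_log n)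
      rw [harmonic_eq_sum_Icc]
      push_cast
      apply Finset.sum_le_sum
      intro k _
      rw [div_eq_mul_inv]
      have : (0:ℝ) ≤ (k:ℝ)⁻¹ := by positivity
      nlinarith [kap_le k]
    refine h1.trans ?_
    have h2 : (fun x : ℝ => 1 + Real.log x) =O[atTop] fun x : ℝ => x ^ (d/2) := by
      apply Asymptotics.IsBigO.add
      · have := (tendsto_rpow_atTop (half_pos hd))
        apply Asymptotics.IsBigO.of_bound 1
        filter_upwards [this.eventually_ge_atTop 1] with x hx
        rw [Real.norm_of_nonneg (by linarith : (0:ℝ) ≤ x ^ (d/2))]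
        simpa using hx
      · exact (isLittleO_log_rpow_atTop (half_pos hd)).isBigO
    exact h2.comp_tendsto tendsto_natCast_atTop_atTop
  have h := LSeries_eq_mul_integral_of_nonneg (fun n => kap n / n) (r := d/2) (by positivity) (s := (d:ℂ)) (by simp; linarith) hO
    (fun n => div_nonneg (kap_nonneg n) (by positivity))
  rw [e1, h]
  push_cast
  congr 1
  have e2 : ∫ t in Set.Ioi (1:ℝ), (∑ k ∈ Finset.Icc 1 ⌊t⌋₊, ((kap k : ℂ) / (k:ℂ))) * (t:ℂ) ^ (-((d:ℂ) + 1)) =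
      ((∫ t in Set.Ioi (1:ℝ), RR t * t ^ (-(d+1)) : ℝ) : ℂ) := by
    rw [← integral_complex_ofReal]
    apply setIntegral_congr_fun measurableSet_Ioi
    intro t ht
    have : (0:ℝ) ≤ t := by linarith [Set.mem_Ioi.1 ht]
    simp only [RR]
    push_cast
    rw [Complex.ofReal_cpow this]
    push_cast
    rfl
  have e3 : ∫ t in Set.Ioi (1:ℝ), RR t * t ^ (-(d+1)) = ∫ w in Set.Ioi (0:ℝ), RR (Real.exp w) * Real.exp (-(d * w)) := by
    have him : Real.exp '' Set.Ioi 0 = Set.Ioi 1 := by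
      ext t; constructor
      · rintro ⟨w, hw, rfl⟩; exact Real.one_lt_exp_iff.2 hw
      · intro ht
        have : 1 < t := ht
        exact ⟨Real.log t, Real.log_pos ht, Real.exp_log (by linarith)⟩
    rw [← him, integral_image_eq_integral_abs_deriv_smul measurableSet_Ioi
      (fun x _ => (Real.hasDerivAt_exp x).hasDerivWithinAt) Real.exp_injective.injOn]
    apply setIntegral_congr_fun measurableSet_Ioi
    intro w _
    simp only [smul_eq_mul, abs_of_pos (Real.exp_pos w)]
    rw [← Real.exp_mul, mul_left_comm, ← Real.exp_add]
    congr 2; ring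
  rw [← e3, ← e2]

noncomputable def EE (w : ℝ) : ℝ := RR (Real.exp w) - (Real.log w + MM)

lemma EE_int : IntegrableOn EE (Set.Ioi 0) := by
  have hs : Set.Ioi (0:ℝ) = Set.Ioc 0 (Real.log 2) ∪ Set.Ioi (Real.log 2) := by
    rw [Set.Ioc_union_Ioi_eq_Ioi (Real.log_nonneg (by norm_num))]
  have hmR : Measurable (fun w => RR (Real.exp w)) := RR_mono.measurable.comp Real.measurable_exp
  have hm : Measurable EE := hmR.sub (Real.measurable_log.add_const _)
  rw [hs]
  apply IntegrableOn.union
  · have h1 : IntegrableOn Real.log (Set.Ioc 0 (Real.log 2)) := by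
      rw [← intervalIntegrable_iff_integrableOn_Ioc_of_le (Real.log_nonneg (by norm_num))]
      exact intervalIntegral.intervalIntegrable_log'
    have h2 : IntegrableOn (fun w => RR (Real.exp w)) (Set.Ioc 0 (Real.log 2)) := by
      have : IntegrableOn (fun _ : ℝ => RR 2) (Set.Ioc 0 (Real.log 2)) := by simp
      refine Integrable.mono' this hmR.aestronglyMeasurable ?_
      rw [ae_restrict_iff' measurableSet_Ioc]
      refine Eventually.of_forall (fun w hw => ?_)
      have h0 : 0 ≤ RR (Real.exp w) := Finset.sum_nonneg (fun n _ => div_nonneg (kap_nonneg n) (by positivity))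
      rw [Real.norm_of_nonneg h0]
      apply RR_mono
      rw [← Real.le_log_iff_exp_le (by norm_num)]; exact hw.2
    exact h2.sub (h1.add (by simp))
  · obtain ⟨C, hC, h⟩ := mertens0 2 (by norm_num)
    have hi : IntegrableOn (fun w : ℝ => C * w ^ (-2:ℝ)) (Set.Ioi (Real.log 2)) :=
      (integrableOn_Ioi_rpow_of_lt (by norm_num) (Real.log_pos (by norm_num))).const_mul C
    refine Integrable.mono' hi hm.aestronglyMeasurable ?_
    rw [ae_restrict_iff' measurableSet_Ioi]
    refine Eventually.of_forall (fun w hw => ?_)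
    have hw' : Real.log 2 < w := hw
    have h0 : 0 < w := lt_trans (Real.log_pos (by norm_num)) hw'
    have := h (Real.exp w) (by rw [← Real.log_le_iff_le_exp (by norm_num)]; exact hw'.le)
    rw [Real.log_exp] at this
    rw [EE, Real.norm_eq_abs, Real.rpow_neg h0.le]
    refine this.trans (le_of_eq ?_)
    norm_cast

lemma MM_eq : MM = Real.eulerMascheroniConstant := by
  set J := ∫ w in Set.Ioi (0:ℝ), |EE w| with hJ
  have hJ0 : 0 ≤ J := integral_nonneg (fun _ => abs_nonneg _)
  have key : ∀ d : ℝ, 0 < d → |(riemannZeta ((1 + d : ℝ) : ℂ)).re.log + Real.log d - (MM - Real.eulerMascheroniConstant)| ≤ d * J := by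
    intro d hd
    have h1 := Fk_integral hd
    have h2 := exp_Fk (s := ((1 + d : ℝ) : ℂ)) (by rw [Complex.ofReal_re]; linarith)
    rw [h1, ← Complex.ofReal_exp] at h2
    rw [← h2, Complex.ofReal_re, Real.log_exp]
    obtain ⟨i1, i2⟩ := int_exp_scaled hd
    obtain ⟨l1, l2⟩ := int_log_scaled hd
    have hEi : IntegrableOn (fun w => EE w * Real.exp (-(d * w))) (Set.Ioi 0) := by
      refine Integrable.mono' EE_int.norm ?_ ?_
      · exact EE_int.aestronglyMeasurable.mul (by fun_prop)
      · rw [ae_restrict_iff' measurableSet_Ioi]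
        refine Eventually.of_forall (fun w hw => ?_)
        have hw' : 0 < w := hw
        rw [norm_mul, Real.norm_of_nonneg (Real.exp_pos _).le]
        have : Real.exp (-(d*w)) ≤ 1 := Real.exp_le_one_iff.2 (by have := mul_pos hd hw'; linarith)
        nlinarith [norm_nonneg (EE w)]
    have e : ∫ w in Set.Ioi (0:ℝ), RR (Real.exp w) * Real.exp (-(d * w)) =
        (∫ w in Set.Ioi (0:ℝ), EE w * Real.exp (-(d * w))) + (∫ w in Set.Ioi (0:ℝ), Real.log w * Real.exp (-(d * w))) + MM * ∫ w in Set.Ioi (0:ℝ), Real.exp (-(d * w)) := by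
      have hA : IntegrableOn (fun w => EE w * Real.exp (-(d * w)) + Real.log w * Real.exp (-(d * w))) (Set.Ioi 0) := hEi.add l1
      rw [← integral_const_mul, ← integral_add hEi l1, ← integral_add hA (i1.const_mul MM)]
      congr 1; ext w; simp only [EE]; ring
    have hb : |∫ w in Set.Ioi (0:ℝ), EE w * Real.exp (-(d * w))| ≤ J := by
      rw [← Real.norm_eq_abs]
      apply norm_integral_le_of_norm_le EE_int.norm
      rw [ae_restrict_iff' measurableSet_Ioi]
      refine Eventually.of_forall (fun w hw => ?_)
      have hw' : 0 < w := hw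
      rw [norm_mul, Real.norm_of_nonneg (Real.exp_pos _).le]
      have : Real.exp (-(d*w)) ≤ 1 := Real.exp_le_one_iff.2 (by have := mul_pos hd hw'; linarith)
      nlinarith [norm_nonneg (EE w)]
    have e2 : d * ((∫ w in Set.Ioi (0:ℝ), EE w * Real.exp (-(d * w))) + (∫ w in Set.Ioi (0:ℝ), Real.log w * Real.exp (-(d * w))) + MM * ∫ w in Set.Ioi (0:ℝ), Real.exp (-(d * w))) =
      d * (∫ w in Set.Ioi (0:ℝ), EE w * Real.exp (-(d * w))) + (d * ∫ w in Set.Ioi (0:ℝ), Real.log w * Real.exp (-(d * w))) + MM * (d * ∫ w in Set.Ioi (0:ℝ), Real.exp (-(d * w))) := by ring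
    rw [e, e2, i2, l2]
    have e3 : ∀ q γ L M : ℝ, d * q + (-γ - L) + M * 1 + L - (M - γ) = d * q := by intros; ring
    rw [e3, abs_mul, abs_of_pos hd]
    gcongr
  have ht := log_riemannZeta_add_log_sub_isLittleO_ofReal
  rw [Asymptotics.isLittleO_one_iff] at ht
  have hsub : Tendsto (fun d : ℝ => 1 + d) (𝓝[>] 0) (𝓝[>] 1) := by
    apply tendsto_nhdsWithin_iff.2
    constructor
    · have : Tendsto (fun d : ℝ => 1 + d) (𝓝 0) (𝓝 (1 + 0)) := (continuous_const.add continuous_id).tendsto 0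
      rw [add_zero] at this
      exact this.mono_left nhdsWithin_le_nhds
    · filter_upwards [self_mem_nhdsWithin] with d hd
      have : 0 < d := hd
      simp; exact this
  have ht2 := ht.comp hsub
  have ht3 : Tendsto (fun d : ℝ => (riemannZeta ((1 + d : ℝ) : ℂ)).re.log + Real.log d) (𝓝[>] 0) (𝓝 (MM - Real.eulerMascheroniConstant)) := by
    rw [tendsto_iff_norm_sub_tendsto_zero]
    have hz : Tendsto (fun d : ℝ => d * J) (𝓝[>] 0) (𝓝 0) := by
      have : Tendsto (fun d : ℝ => d * J) (𝓝 0) (𝓝 (0 * J)) := (continuous_id.mul continuous_const).tendsto 0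
      rw [zero_mul] at this
      exact this.mono_left nhdsWithin_le_nhds
    refine squeeze_zero' (Eventually.of_forall (fun _ => norm_nonneg _)) ?_ hz
    filter_upwards [self_mem_nhdsWithin] with d hd
    exact key d hd
  have ht4 : Tendsto (fun d : ℝ => (riemannZeta ((1 + d : ℝ) : ℂ)).re.log + Real.log d) (𝓝[>] 0) (𝓝 0) := by
    refine ht2.congr (fun d => ?_)
    simp
  have := tendsto_nhds_unique ht3 ht4
  linarith

theorem mertens (A : ℕ) (hA : 1 ≤ A) : ∃ C : ℝ, 0 < C ∧ ∀ y : ℝ, 2 ≤ y →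
    |RR y - (Real.log (Real.log y) + Real.eulerMascheroniConstant)| ≤ C / Real.log y ^ A := by
  rw [← MM_eq]; exact mertens0 A hA
end Stmt9

set_option linter.all false
namespace Stmt9
open Filter Topology MeasureTheory

noncomputable def TT (x : ℝ) : ℝ := ∑ n ∈ Finset.Icc 1 ⌊x⌋₊, kap n * (⌊x / n⌋₊ : ℝ)

lemma TT_split {x s : ℝ} (hs : 1 ≤ s) (hx : s * s = x) :
    TT x = ∑ n ∈ Finset.Icc 1 ⌊s⌋₊, kap n * (⌊x / n⌋₊ : ℝ) + ∑ m ∈ Finset.Icc 1 ⌊s⌋₊, (KK (x / m) - KK s) := by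
  have hsx : s ≤ x := by nlinarith
  have hx0 : 0 < x := by linarith
  rw [TT, sum_split _ (Nat.floor_le_floor hsx)]
  congr 1
  have h1 : ∀ n ∈ Finset.Ioc ⌊s⌋₊ ⌊x⌋₊, kap n * (⌊x / n⌋₊ : ℝ) = ∑ m ∈ Finset.Icc 1 ⌊s⌋₊, if (m:ℝ) * n ≤ x then kap n else 0 := by
    intro n hn
    rw [Finset.mem_Ioc] at hn
    have hn1 : s < n := Nat.lt_of_floor_lt hn.1
    have hn0 : (0:ℝ) < n := by linarith
    rw [← Finset.sum_filter]
    have : (Finset.Icc 1 ⌊s⌋₊).filter (fun m : ℕ => (m:ℝ) * n ≤ x) = Finset.Icc 1 ⌊x / n⌋₊ := by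
      ext m
      rw [Finset.mem_filter, Finset.mem_Icc, Finset.mem_Icc, Nat.le_floor_iff (by linarith), Nat.le_floor_iff (by positivity), le_div_iff₀ hn0]
      constructor
      · rintro ⟨⟨a, b⟩, c⟩; exact ⟨a, c⟩
      · rintro ⟨a, b⟩
        refine ⟨⟨a, ?_⟩, b⟩
        by_contra h
        push Not at h
        nlinarith
    rw [this, Finset.sum_const, Nat.card_Icc, nsmul_eq_mul]
    simp; ring
  rw [Finset.sum_congr rfl h1, Finset.sum_comm]
  refine Finset.sum_congr rfl (fun m hm => ?_)
  rw [Finset.mem_Icc] at hm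
  have hm1 : (1:ℝ) ≤ m := by exact_mod_cast hm.1
  have hms : (m:ℝ) ≤ s := (Nat.le_floor_iff (by linarith)).1 hm.2
  have hsm : s ≤ x / m := by rw [le_div_iff₀ (by linarith)]; nlinarith
  rw [KK, KK, sum_split kap (Nat.floor_le_floor hsm), add_sub_cancel_left, ← Finset.sum_filter]
  apply Finset.sum_congr _ (fun _ _ => rfl)
  ext n
  rw [Finset.mem_filter, Finset.mem_Ioc, Finset.mem_Ioc, Nat.le_floor_iff (by linarith), Nat.le_floor_iff (by positivity), le_div_iff₀ (by linarith)]
  constructor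
  · rintro ⟨⟨a, b⟩, c⟩; exact ⟨a, by linarith⟩
  · rintro ⟨a, b⟩
    refine ⟨⟨a, ?_⟩, by linarith⟩
    have : (n:ℝ) * 1 ≤ n * m := by gcongr
    linarith

lemma first_part {x s : ℝ} (hs : 1 ≤ s) (hx : s * s = x) :
    |∑ n ∈ Finset.Icc 1 ⌊s⌋₊, kap n * (⌊x / n⌋₊ : ℝ) - x * RR s| ≤ s := by
  have hx0 : 0 < x := by nlinarith
  rw [RR, Finset.mul_sum, ← Finset.sum_sub_distrib]
  refine (Finset.abs_sum_le_sum_abs _ _).trans ?_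
  have : ∀ n ∈ Finset.Icc 1 ⌊s⌋₊, |kap n * (⌊x / n⌋₊ : ℝ) - x * (kap n / n)| ≤ 1 := by
    intro n hn
    have e : kap n * (⌊x / n⌋₊ : ℝ) - x * (kap n / n) = kap n * ((⌊x / n⌋₊ : ℝ) - x / n) := by ring
    rw [e, abs_mul, abs_of_nonneg (kap_nonneg n)]
    have h1 : |(⌊x / n⌋₊ : ℝ) - x / n| ≤ 1 := by
      have := Nat.floor_le (show 0 ≤ x / n by positivity)
      have := Nat.lt_floor_add_one (x / n)
      rw [abs_le]; constructor <;> linarith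
    exact mul_le_one₀ (kap_le n) (abs_nonneg _) h1
  refine (Finset.sum_le_card_nsmul _ _ _ this).trans ?_
  rw [Nat.card_Icc]
  simp
  exact Nat.floor_le (by linarith)

lemma second_part (A : ℕ) (hA : 1 ≤ A) : ∃ C : ℝ, 0 < C ∧ ∀ x s : ℝ, 4 ≤ s → s * s = x →
    |∑ m ∈ Finset.Icc 1 ⌊s⌋₊, (KK (x / m) - KK s) - ∑ m ∈ Finset.Icc 1 ⌊s⌋₊, (li (x / m) - li s)| ≤ C * (x / Real.log x ^ A) := by
  obtain ⟨C, hC, h⟩ := DD_bound A hA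
  refine ⟨C * 2 ^ (A+1) * 3, by positivity, fun x s hs hx => ?_⟩
  have hx0 : 0 < x := by nlinarith
  have hs0 : 0 < s := by linarith
  have hlog : Real.log x = 2 * Real.log s := by rw [← hx, Real.log_mul hs0.ne' hs0.ne']; ring
  have hl1 : 1 < Real.log s := by
    rw [Real.lt_log_iff_exp_lt hs0]; linarith [Real.exp_one_lt_d9]
  rw [← Finset.sum_sub_distrib]
  refine (Finset.abs_sum_le_sum_abs _ _).trans ?_
  have hb : ∀ y : ℝ, s ≤ y → |DD y| ≤ C * 2 ^ (A+1) / Real.log x ^ (A+1) * y := by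
    intro y hy
    refine (h y (by linarith)).trans ?_
    have h1 : Real.log x / 2 ≤ Real.log y := by rw [hlog]; linarith [Real.log_le_log hs0 hy]
    have h2 : (Real.log x / 2) ^ (A+1) ≤ Real.log y ^ (A+1) := pow_le_pow_left₀ (by linarith) h1 _
    have h3 : 0 < (Real.log x / 2) ^ (A+1) := by have : 0 < Real.log x / 2 := by linarith
                                                 positivity
    calc C * (y / Real.log y ^ (A+1)) ≤ C * (y / (Real.log x / 2) ^ (A+1)) := by
          have : 0 ≤ y := by linarith
          gcongr
      _ = _ := by rw [div_pow]; field_simp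
  set Q := C * 2 ^ (A+1) / Real.log x ^ (A+1) with hQ
  have hlx : 0 < Real.log x := by linarith
  have hQ0 : 0 < Q := by positivity
  have h1 : ∀ m ∈ Finset.Icc 1 ⌊s⌋₊, |KK (x / m) - KK s - (li (x / m) - li s)| ≤ Q * x * (m:ℝ)⁻¹ + Q * s := by
    intro m hm
    rw [Finset.mem_Icc] at hm
    have hm1 : (1:ℝ) ≤ m := by exact_mod_cast hm.1
    have hms : (m:ℝ) ≤ s := (Nat.le_floor_iff (by linarith)).1 hm.2
    have hsm : s ≤ x / m := by rw [le_div_iff₀ (by linarith)]; nlinarith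
    have e : KK (x / m) - KK s - (li (x / m) - li s) = DD (x / m) - DD s := by rw [DD, DD]; ring
    rw [e]
    refine (abs_sub _ _).trans ?_
    have := hb _ hsm
    have h2 := hb s le_rfl
    have e2 : Q * x * (m:ℝ)⁻¹ = Q * (x / m) := by ring
    linarith
  refine (Finset.sum_le_sum h1).trans ?_
  rw [Finset.sum_add_distrib, ← Finset.mul_sum, Finset.sum_const, Nat.card_Icc, nsmul_eq_mul]
  have h2 : ∑ m ∈ Finset.Icc 1 ⌊s⌋₊, (m:ℝ)⁻¹ ≤ 2 * Real.log x := by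
    have := harmonic_floor_le_one_add_log s (by linarith)
    rw [harmonic_eq_sum_Icc] at this
    push_cast at this
    linarith
  have h3 : ((⌊s⌋₊ + 1 - 1 : ℕ) : ℝ) ≤ s := by simp; exact Nat.floor_le hs0.le
  have h4 : ((⌊s⌋₊ + 1 - 1 : ℕ) : ℝ) * (Q * s) ≤ s * (Q * s) := by gcongr
  have h5 : Q * x * ∑ m ∈ Finset.Icc 1 ⌊s⌋₊, (m:ℝ)⁻¹ ≤ Q * x * (2 * Real.log x) := by gcongr
  have h6 : s * (Q * s) = Q * x * 1 := by rw [← hx]; ring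
  have h7 : Q * x * 1 ≤ Q * x * Real.log x := by gcongr; linarith
  have h8 : Q * x * Real.log x * 3 = C * 2 ^ (A+1) * 3 * (x / Real.log x ^ A) := by
    rw [hQ, pow_succ (Real.log x)]; field_simp
  linarith

lemma li_sum {x s : ℝ} (hs : 4 ≤ s) (hx : s * s = x) :
    IntegrableOn (fun t : ℝ => (t ^ 2 * (Real.log x - Real.log t))⁻¹) (Set.Icc 1 s) ∧
    ∑ m ∈ Finset.Icc 1 ⌊s⌋₊, (li (x / m) - li s) = x * ∫ t in Set.Ioc 1 s, (t ^ 2 * (Real.log x - Real.log t))⁻¹ * (⌊t⌋₊ : ℝ) := by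
  have hx0 : 0 < x := by nlinarith
  have hs0 : 0 < s := by linarith
  have hlog : Real.log x = 2 * Real.log s := by rw [← hx, Real.log_mul hs0.ne' hs0.ne']; ring
  have hl1 : 1 < Real.log s := by
    rw [Real.lt_log_iff_exp_lt hs0]; linarith [Real.exp_one_lt_d9]
  have hpos : ∀ t : ℝ, t ∈ Set.Icc 1 s → 0 < Real.log x - Real.log t := by
    intro t ht
    have := Real.log_le_log (by linarith [ht.1]) ht.2
    linarith
  have hder : ∀ t : ℝ, t ∈ Set.Icc 1 s → HasDerivAt (fun t => li (x / t) - li s) (-x * (t ^ 2 * (Real.log x - Real.log t))⁻¹) t := by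
    intro t ht
    have ht0 : 0 < t := by linarith [ht.1]
    have h2 : 2 ≤ x / t := by rw [le_div_iff₀ ht0]; nlinarith [ht.2]
    have h3 : HasDerivAt (fun t : ℝ => x / t) (-x / t ^ 2) t := by
      have := (hasDerivAt_const t x).div (hasDerivAt_id t) ht0.ne'
      refine this.congr_deriv ?_
      simp
    have h4 := ((li_deriv' h2).comp t h3).sub_const (li s)
    refine h4.congr_deriv ?_
    rw [Real.log_div hx0.ne' ht0.ne']
    have := (hpos t ht).ne'
    field_simp
  have hc : ContinuousOn (fun t : ℝ => (t ^ 2 * (Real.log x - Real.log t))⁻¹) (Set.Icc 1 s) := by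
    apply ContinuousOn.inv₀
    · apply ContinuousOn.mul (by fun_prop)
      apply continuousOn_const.sub
      apply Real.continuousOn_log.mono
      intro t ht; simp; linarith [ht.1]
    · intro t ht
      have := hpos t ht
      have : 0 < t := by linarith [ht.1]
      positivity
  refine ⟨hc.integrableOn_Icc, ?_⟩
  have hdi : IntegrableOn (deriv (fun t => li (x / t) - li s)) (Set.Icc 1 s) := by
    have hc2 : ContinuousOn (fun t : ℝ => -x * (t^2*(Real.log x - Real.log t))⁻¹) (Set.Icc 1 s) := continuousOn_const.mul hc
    have hc3 : ContinuousOn (deriv (fun t => li (x / t) - li s)) (Set.Icc 1 s) := by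
      apply hc2.congr
      intro t ht
      exact (hder t ht).deriv
    exact hc3.integrableOn_Icc
  have hab := sum_mul_eq_sub_sub_integral_mul (fun n : ℕ => if n = 0 then (0:ℝ) else 1) (f := fun t => li (x / t) - li s) (a := 1) (b := s) (by norm_num) (by linarith)
    (fun t ht => (hder t ht).differentiableAt) hdi
  have hcount : ∀ N : ℕ, ∑ k ∈ Finset.Icc 0 N, (if k = 0 then (0:ℝ) else 1) = N := by
    intro N
    rw [sum_Icc_zero _ (by simp)]
    rw [Finset.sum_congr rfl (g := fun _ => (1:ℝ))]
    · simp
    · intro k hk; rw [Finset.mem_Icc] at hk; rw [if_neg (by omega)]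
  simp_rw [hcount] at hab
  have hxs : x / s = s := by rw [← hx]; field_simp
  rw [hxs, sub_self, zero_mul, zero_sub] at hab
  have e1 : ∑ k ∈ Finset.Ioc ⌊(1:ℝ)⌋₊ ⌊s⌋₊, (li (x / k) - li s) * (if k = 0 then (0:ℝ) else 1) = ∑ k ∈ Finset.Ioc 1 ⌊s⌋₊, (li (x / k) - li s) := by
    rw [Nat.floor_one]
    refine Finset.sum_congr rfl (fun k hk => ?_)
    rw [Finset.mem_Ioc] at hk
    rw [if_neg (by omega), mul_one]
  rw [e1] at hab
  have hfl : 1 ≤ ⌊s⌋₊ := Nat.le_floor (by push_cast; linarith)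
  rw [sum_split _ hfl, hab]
  have e2 : ∫ t in Set.Ioc 1 s, deriv (fun t => li (x / t) - li s) t * (⌊t⌋₊ : ℝ) = -(x * ∫ t in Set.Ioc 1 s, (t ^ 2 * (Real.log x - Real.log t))⁻¹ * (⌊t⌋₊ : ℝ)) := by
    rw [← integral_const_mul, ← integral_neg]
    apply setIntegral_congr_fun measurableSet_Ioc
    intro t ht
    simp only
    rw [(hder t ⟨ht.1.le, ht.2⟩).deriv]; ring
  rw [e2]
  simp
  ring
end Stmt9

set_option linter.all false
namespace Stmt9
open Filter Topology MeasureTheory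

noncomputable def gg (k : ℕ) (t : ℝ) : ℝ := (t - (⌊t⌋₊ : ℝ)) * (Real.log t) ^ k / t ^ 2

lemma fr_bd {t : ℝ} (ht : 1 ≤ t) : 0 ≤ t - (⌊t⌋₊ : ℝ) ∧ t - (⌊t⌋₊ : ℝ) ≤ 1 := by
  constructor
  · linarith [Nat.floor_le (by linarith : 0 ≤ t)]
  · linarith [Nat.lt_floor_add_one t]

lemma gg_bound (k : ℕ) : ∃ C > 0, ∀ t : ℝ, 1 ≤ t → 0 ≤ gg k t ∧ gg k t ≤ C * t ^ (-(3/2:ℝ)) := by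
  obtain ⟨C, hC, h⟩ := log_pow_le k
  refine ⟨C + 1, by linarith, fun t ht => ?_⟩
  have ht0 : 0 < t := by linarith
  have hl0 : 0 ≤ Real.log t := Real.log_nonneg ht
  have hsq : 1 ≤ √t := by rw [Real.one_le_sqrt]; exact ht
  have hlog : Real.log t ^ k ≤ (C + 1) * √t := by
    rcases le_or_gt 2 t with h2 | h2
    · have := h t h2
      nlinarith
    · have : Real.log t ≤ 1 := by linarith [Real.log_le_sub_one_of_pos ht0]
      have : Real.log t ^ k ≤ 1 := pow_le_one₀ hl0 this
      nlinarith
  obtain ⟨f1, f2⟩ := fr_bd ht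
  unfold gg
  constructor
  · positivity
  · have e : t ^ (-(3/2:ℝ)) = √t / t ^ 2 := by
      rw [Real.sqrt_eq_rpow, ← Real.rpow_natCast t 2, ← Real.rpow_sub ht0]; norm_num
    rw [e, ← mul_div_assoc]
    refine div_le_div_of_nonneg_right ?_ (by positivity)
    calc (t - (⌊t⌋₊ : ℝ)) * Real.log t ^ k ≤ 1 * Real.log t ^ k := by gcongr
      _ ≤ _ := by linarith

lemma gg_meas (k : ℕ) : Measurable (gg k) := by
  unfold gg
  have : Measurable (fun t : ℝ => (⌊t⌋₊ : ℝ)) := measurable_from_nat.comp Nat.measurable_floor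
  have h2 := Real.measurable_log
  fun_prop

lemma gg_tail (k : ℕ) : ∃ C > 0, IntegrableOn (gg k) (Set.Ioi 1) ∧ ∀ s : ℝ, 1 ≤ s → |∫ t in Set.Ioi s, gg k t| ≤ C / √s := by
  obtain ⟨C, hC, h⟩ := gg_bound k
  have hi : ∀ s : ℝ, 1 ≤ s → IntegrableOn (fun t : ℝ => C * t ^ (-(3/2:ℝ))) (Set.Ioi s) := by
    intro s hs
    exact (integrableOn_Ioi_rpow_of_lt (by norm_num) (by linarith)).const_mul C
  refine ⟨2 * C, by linarith, ?_, ?_⟩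
  · refine Integrable.mono' (hi 1 le_rfl) (gg_meas k).aestronglyMeasurable ?_
    filter_upwards [ae_restrict_mem measurableSet_Ioi] with t ht
    obtain ⟨a, b⟩ := h t (le_of_lt ht)
    rw [Real.norm_eq_abs, abs_of_nonneg a]; exact b
  · intro s hs
    have := norm_integral_le_of_norm_le (hi s hs) (f := gg k) (by
      filter_upwards [ae_restrict_mem measurableSet_Ioi] with t ht
      obtain ⟨a, b⟩ := h t (le_of_lt (lt_of_le_of_lt hs ht))
      rw [Real.norm_eq_abs, abs_of_nonneg a]; exact b)
    rw [Real.norm_eq_abs, integral_const_mul, integral_Ioi_rpow_of_lt (by norm_num) (by linarith)] at this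
    refine this.trans (le_of_eq ?_)
    rw [Real.sqrt_eq_rpow, div_eq_mul_inv (2 * C), ← Real.rpow_neg (by linarith)]
    norm_num
    ring

lemma geo_id (L u : ℝ) (hL : 0 < L) (hu : 0 < L - u) (N : ℕ) :
    (L - u)⁻¹ = ∑ j ∈ Finset.Icc 1 N, u ^ (j - 1) / L ^ j + u ^ N / (L ^ N * (L - u)) := by
  induction N with
  | zero => simp
  | succ n ih =>
    rw [Finset.sum_Icc_succ_top (by omega), ih]
    simp only [Nat.add_sub_cancel]
    field_simp
    ring

lemma int_log2 {x s : ℝ} (hs : 4 ≤ s) (hx : s * s = x) :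
    IntegrableOn (fun t : ℝ => (t * (Real.log x - Real.log t))⁻¹) (Set.Ioc 1 s) ∧
    ∫ t in Set.Ioc 1 s, (t * (Real.log x - Real.log t))⁻¹ = Real.log 2 := by
  have hs0 : 0 < s := by linarith
  have hlog : Real.log x = 2 * Real.log s := by rw [← hx, Real.log_mul hs0.ne' hs0.ne']; ring
  have hl1 : 1 < Real.log s := by
    rw [Real.lt_log_iff_exp_lt hs0]; linarith [Real.exp_one_lt_d9]
  have hpos : ∀ t : ℝ, t ∈ Set.Icc 1 s → 0 < Real.log x - Real.log t := by
    intro t ht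
    have := Real.log_le_log (by linarith [ht.1]) ht.2
    linarith
  have hc : ContinuousOn (fun t : ℝ => (t * (Real.log x - Real.log t))⁻¹) (Set.Icc 1 s) := by
    apply ContinuousOn.inv₀
    · apply ContinuousOn.mul (by fun_prop)
      apply continuousOn_const.sub
      apply Real.continuousOn_log.mono
      intro t ht; simp; linarith [ht.1]
    · intro t ht
      have := hpos t ht
      have : 0 < t := by linarith [ht.1]
      positivity
  have hI := hc.integrableOn_Icc (μ := volume)
  refine ⟨hI.mono_set Set.Ioc_subset_Icc_self, ?_⟩
  rw [← intervalIntegral.integral_of_le (by linarith : (1:ℝ) ≤ s)]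
  rw [intervalIntegral.integral_eq_sub_of_hasDerivAt (f := fun t => - Real.log (Real.log x - Real.log t))]
  · rw [hlog, Real.log_one]
    rw [show 2 * Real.log s - Real.log s = Real.log s by ring, sub_zero, Real.log_mul (by norm_num) (by linarith)]
    ring
  · intro t ht
    rw [Set.uIcc_of_le (by linarith)] at ht
    have ht0 : 0 < t := by linarith [ht.1]
    have h1 := hpos t ht
    have := (((hasDerivAt_const t (Real.log x)).sub (Real.hasDerivAt_log ht0.ne')).log h1.ne').neg
    refine this.congr_deriv ?_
    simp
    field_simp
  · apply ContinuousOn.intervalIntegrable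
    rw [Set.uIcc_of_le (by linarith)]; exact hc

lemma frac_int (N : ℕ) : ∃ C > 0, ∀ x s : ℝ, 4 ≤ s → s * s = x →
    IntegrableOn (fun t : ℝ => (t - (⌊t⌋₊ : ℝ)) * (t ^ 2 * (Real.log x - Real.log t))⁻¹) (Set.Ioc 1 s) ∧
    |(∫ t in Set.Ioc 1 s, (t - (⌊t⌋₊ : ℝ)) * (t ^ 2 * (Real.log x - Real.log t))⁻¹)
      - ∑ j ∈ Finset.Icc 1 N, (∫ t in Set.Ioi 1, gg (j-1) t) / Real.log x ^ j| ≤ C / Real.log x ^ (N+1) := by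
  choose Ct hCt hint htail using gg_tail
  obtain ⟨Cl, hCl, hlp⟩ := log_pow_le (N+1)
  set B := ∫ t in Set.Ioi 1, gg N t with hB
  have hB0 : 0 ≤ B := by
    apply setIntegral_nonneg measurableSet_Ioi
    intro t ht
    obtain ⟨c, hc, h⟩ := gg_bound N
    exact (h t (le_of_lt ht)).1
  have hCs : 0 ≤ ∑ j ∈ Finset.Icc 1 N, Ct (j-1) := Finset.sum_nonneg (fun j _ => (hCt _).le)
  refine ⟨(∑ j ∈ Finset.Icc 1 N, Ct (j-1)) * (Cl * 2 ^ (N+1)) + 2 * B + 1, by positivity, ?_⟩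
  intro x s hs hx
  have hs0 : 0 < s := by linarith
  have hlog : Real.log x = 2 * Real.log s := by rw [← hx, Real.log_mul hs0.ne' hs0.ne']; ring
  have hl1 : 1 < Real.log s := by
    rw [Real.lt_log_iff_exp_lt hs0]; linarith [Real.exp_one_lt_d9]
  set L := Real.log x with hL
  have hL1 : 1 ≤ L := by linarith
  have hL0 : 0 < L := by linarith
  have hlt : ∀ t : ℝ, t ∈ Set.Ioc 1 s → 0 < t ∧ 0 ≤ Real.log t ∧ L / 2 ≤ L - Real.log t := by
    intro t ht
    have := Real.log_le_log (by linarith [ht.1]) ht.2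
    exact ⟨by linarith [ht.1], Real.log_nonneg ht.1.le, by linarith⟩
  have hgI : ∀ k, IntegrableOn (gg k) (Set.Ioc 1 s) := fun k => (hint k).mono_set Set.Ioc_subset_Ioi_self
  -- remainder function
  set E : ℝ → ℝ := fun t => gg N t * (L ^ N * (L - Real.log t))⁻¹ with hE
  have hEb : ∀ t ∈ Set.Ioc 1 s, ‖E t‖ ≤ 2 / L ^ (N+1) * gg N t := by
    intro t ht
    obtain ⟨h1, h2, h3⟩ := hlt t ht
    obtain ⟨c, hc, h⟩ := gg_bound N
    have hg := (h t ht.1.le).1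
    have h4 : 0 < L - Real.log t := by linarith
    have h5 : (L ^ N * (L - Real.log t))⁻¹ ≤ 2 / L ^ (N+1) := by
      rw [inv_eq_one_div, div_le_div_iff₀ (by positivity) (by positivity), pow_succ]
      have : L ^ N * (L/2) ≤ L ^ N * (L - Real.log t) := by gcongr
      linarith
    rw [Real.norm_eq_abs, abs_of_nonneg (by simp only [hE]; positivity)]
    simp only [hE]
    rw [mul_comm]
    gcongr
  have hEm : Measurable E := by
    have := gg_meas N
    have h2 := Real.measurable_log
    simp only [hE]
    fun_prop
  have hdom : IntegrableOn (fun t => 2 / L ^ (N+1) * gg N t) (Set.Ioc 1 s) := (hgI N).const_mul _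
  have hEI : IntegrableOn E (Set.Ioc 1 s) := by
    refine Integrable.mono' hdom hEm.aestronglyMeasurable ?_
    filter_upwards [ae_restrict_mem measurableSet_Ioc] with t ht using hEb t ht
  have hEbd : |∫ t in Set.Ioc 1 s, E t| ≤ 2 * B / L ^ (N+1) := by
    have h1 := norm_integral_le_of_norm_le hdom (f := E) (by
      filter_upwards [ae_restrict_mem measurableSet_Ioc] with t ht using hEb t ht)
    rw [integral_const_mul] at h1
    have h2 : ∫ t in Set.Ioc 1 s, gg N t ≤ B := by
      apply setIntegral_mono_set (hint N)
      · filter_upwards [ae_restrict_mem measurableSet_Ioi] with t ht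
        obtain ⟨c, hc, h⟩ := gg_bound N
        exact (h t (le_of_lt ht)).1
      · exact Set.Ioc_subset_Ioi_self.eventuallyLE
    refine h1.trans ?_
    calc 2 / L ^ (N+1) * ∫ t in Set.Ioc 1 s, gg N t ≤ 2 / L ^ (N+1) * B := by gcongr
      _ = _ := by ring
  have hpt : Set.EqOn (fun t : ℝ => (t - (⌊t⌋₊ : ℝ)) * (t ^ 2 * (L - Real.log t))⁻¹)
      (fun t => ∑ j ∈ Finset.Icc 1 N, gg (j-1) t / L ^ j + E t) (Set.Ioc 1 s) := by
    intro t ht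
    obtain ⟨h1, h2, h3⟩ := hlt t ht
    have h4 : 0 < L - Real.log t := by linarith
    simp only [hE]
    rw [mul_inv, geo_id L (Real.log t) hL0 h4 N, mul_add, mul_add, Finset.mul_sum, Finset.mul_sum]
    congr 1
    · refine Finset.sum_congr rfl (fun j _ => ?_)
      unfold gg; ring
    · unfold gg; ring
  have hSI : IntegrableOn (fun t => ∑ j ∈ Finset.Icc 1 N, gg (j-1) t / L ^ j) (Set.Ioc 1 s) :=
    integrable_finset_sum _ (fun j _ => (hgI (j-1)).div_const _)
  have hFI : IntegrableOn (fun t => ∑ j ∈ Finset.Icc 1 N, gg (j-1) t / L ^ j + E t) (Set.Ioc 1 s) := hSI.add hEI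
  refine ⟨hFI.congr_fun hpt.symm measurableSet_Ioc, ?_⟩
  rw [setIntegral_congr_fun measurableSet_Ioc hpt, integral_add hSI hEI, integral_finset_sum _ (fun j _ => (hgI (j-1)).div_const _)]
  have hsplit : ∀ k, ∫ t in Set.Ioi 1, gg k t = (∫ t in Set.Ioc 1 s, gg k t) + ∫ t in Set.Ioi s, gg k t := by
    intro k
    rw [← setIntegral_union (Set.Ioc_disjoint_Ioi le_rfl) measurableSet_Ioi (hgI k) ((hint k).mono_set (Set.Ioi_subset_Ioi (by linarith))), Set.Ioc_union_Ioi_eq_Ioi (by linarith)]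
  have hval : (∑ j ∈ Finset.Icc 1 N, ∫ t in Set.Ioc 1 s, gg (j-1) t / L ^ j) + (∫ t in Set.Ioc 1 s, E t)
      - ∑ j ∈ Finset.Icc 1 N, (∫ t in Set.Ioi 1, gg (j-1) t) / L ^ j
      = (∫ t in Set.Ioc 1 s, E t) - ∑ j ∈ Finset.Icc 1 N, (∫ t in Set.Ioi s, gg (j-1) t) / L ^ j := by
    simp_rw [hsplit, integral_div, add_div, Finset.sum_add_distrib]
    ring
  rw [hval]
  have hsum : |∑ j ∈ Finset.Icc 1 N, (∫ t in Set.Ioi s, gg (j-1) t) / L ^ j| ≤ (∑ j ∈ Finset.Icc 1 N, Ct (j-1)) * (Cl * 2 ^ (N+1)) / L ^ (N+1) := by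
    have hsl : 1 / √s ≤ Cl * 2 ^ (N+1) / L ^ (N+1) := by
      have := hlp s (by linarith)
      rw [div_le_div_iff₀ (Real.sqrt_pos.2 hs0) (by positivity), hlog, mul_pow]
      have h2 : (2:ℝ) ^ (N+1) * Real.log s ^ (N+1) ≤ 2 ^ (N+1) * (Cl * √s) := by gcongr
      linarith
    refine (Finset.abs_sum_le_sum_abs _ _).trans ?_
    rw [mul_div_assoc, Finset.sum_mul]
    refine Finset.sum_le_sum (fun j _ => ?_)
    rw [abs_div, abs_of_pos (by positivity : 0 < L ^ j)]
    calc |∫ t in Set.Ioi s, gg (j-1) t| / L ^ j ≤ |∫ t in Set.Ioi s, gg (j-1) t| / 1 := by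
          gcongr; exact one_le_pow₀ hL1
      _ ≤ Ct (j-1) * (1 / √s) := by
          have := htail (j-1) s (by linarith)
          rw [div_one, mul_one_div]; exact this
      _ ≤ _ := by have := hCt (j-1); gcongr
  have := abs_sub (∫ t in Set.Ioc 1 s, E t) (∑ j ∈ Finset.Icc 1 N, (∫ t in Set.Ioi s, gg (j-1) t) / L ^ j)
  have hfin : 0 ≤ 1 / L ^ (N+1) := by positivity
  rw [add_div, add_div]
  have h9 := abs_sub_abs_le_abs_sub (∫ t in Set.Ioc 1 s, E t) (∑ j ∈ Finset.Icc 1 N, (∫ t in Set.Ioi s, gg (j-1) t) / L ^ j)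
  have h10 := norm_sub_le (∫ t in Set.Ioc 1 s, E t) (∑ j ∈ Finset.Icc 1 N, (∫ t in Set.Ioi s, gg (j-1) t) / L ^ j)
  simp only [Real.norm_eq_abs] at h10
  linarith

theorem TT_asymp (N : ℕ) : ∃ C > 0, ∀ x : ℝ, 16 ≤ x →
    |TT x - (x * Real.log (Real.log x) + Real.eulerMascheroniConstant * x
      - x * ∑ j ∈ Finset.Icc 1 N, (∫ t in Set.Ioi 1, gg (j-1) t) / Real.log x ^ j)| ≤ C * (x / Real.log x ^ (N+1)) := by
  obtain ⟨C1, hC1, h1⟩ := mertens (N+1) (by omega)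
  obtain ⟨C2, hC2, h2⟩ := second_part (A := N+1) (by omega)
  obtain ⟨C3, hC3, h3⟩ := frac_int N
  obtain ⟨C4, hC4, h4⟩ := log_pow_le (N+1)
  refine ⟨C1 * 2 ^ (N+1) + C2 + C3 + C4, by positivity, fun x hx16 => ?_⟩
  set s := √x with hs
  have hx0 : 0 < x := by linarith
  have hsx : s * s = x := Real.mul_self_sqrt hx0.le
  have hs4 : 4 ≤ s := by rw [hs]; apply Real.le_sqrt_of_sq_le; linarith
  have hs0 : 0 < s := by linarith
  have hlog : Real.log x = 2 * Real.log s := by rw [← hsx, Real.log_mul hs0.ne' hs0.ne']; ring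
  have hl1 : 1 < Real.log s := by
    rw [Real.lt_log_iff_exp_lt hs0]; linarith [Real.exp_one_lt_d9]
  have a1 := h1 s (by linarith)
  have a2 := h2 x s hs4 hsx
  obtain ⟨b3, a3⟩ := h3 x s hs4 hsx
  have a4 := h4 x (by linarith)
  have a5 := first_part (x := x) (s := s) (by linarith) hsx
  obtain ⟨b6, a6⟩ := li_sum hs4 hsx
  obtain ⟨b7, a7⟩ := int_log2 hs4 hsx
  set L := Real.log x with hL
  have hL0 : 0 < L := by linarith
  rw [TT_split (by linarith) hsx]
  have e6 : ∫ t in Set.Ioc 1 s, (t ^ 2 * (L - Real.log t))⁻¹ * (⌊t⌋₊ : ℝ) =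
      Real.log 2 - ∫ t in Set.Ioc 1 s, (t - (⌊t⌋₊ : ℝ)) * (t ^ 2 * (L - Real.log t))⁻¹ := by
    rw [← a7, ← integral_sub b7 b3]
    apply setIntegral_congr_fun measurableSet_Ioc
    intro t ht
    have : 0 < t := by linarith [ht.1]
    simp only
    rw [mul_inv, mul_inv]
    field_simp
    ring
  rw [e6] at a6
  set P1 := ∑ n ∈ Finset.Icc 1 ⌊s⌋₊, kap n * (⌊x / n⌋₊ : ℝ)
  set P2 := ∑ m ∈ Finset.Icc 1 ⌊s⌋₊, (KK (x / m) - KK s)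
  set P3 := ∑ m ∈ Finset.Icc 1 ⌊s⌋₊, (li (x / m) - li s)
  set I := ∫ t in Set.Ioc 1 s, (t - (⌊t⌋₊ : ℝ)) * (t ^ 2 * (L - Real.log t))⁻¹
  set S := ∑ j ∈ Finset.Icc 1 N, (∫ t in Set.Ioi 1, gg (j-1) t) / L ^ j
  set M := RR s - (Real.log (Real.log s) + Real.eulerMascheroniConstant) with hM
  have hll : Real.log L = Real.log 2 + Real.log (Real.log s) := by
    rw [hlog, Real.log_mul (by norm_num) (by linarith)]
  have c1 : |x * M| ≤ C1 * 2 ^ (N+1) * (x / L ^ (N+1)) := by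
    rw [abs_mul, abs_of_pos hx0]
    calc x * |M| ≤ x * (C1 / Real.log s ^ (N+1)) := by gcongr
      _ = _ := by rw [hlog, mul_pow]; field_simp
  have c3 : |x * (I - S)| ≤ C3 * (x / L ^ (N+1)) := by
    rw [abs_mul, abs_of_pos hx0]
    calc x * |I - S| ≤ x * (C3 / L ^ (N+1)) := by gcongr
      _ = _ := by ring
  have c4 : s ≤ C4 * (x / L ^ (N+1)) := by
    rw [← mul_div_assoc, le_div_iff₀ (by positivity)]
    calc s * L ^ (N+1) ≤ s * (C4 * s) := by gcongr
      _ = C4 * x := by rw [← hsx]; ring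
  have key : P1 + P2 - (x * Real.log L + Real.eulerMascheroniConstant * x - x * S)
      = (P1 - x * RR s) + (P2 - P3) + x * M - x * (I - S) := by
    rw [hll, a6, hM]; ring
  rw [key]
  rw [abs_le] at *
  constructor <;> linarith [a5.1, a5.2, a2.1, a2.2, c1.1, c1.2, c3.1, c3.2]
end Stmt9

set_option linter.all false
namespace Stmt9
open Filter Topology MeasureTheory

/-- increments of `k ↦ k ^ l` with value one at one -/
noncomputable def hh (l k : ℕ) : ℝ := if k = 0 then 0 else (k:ℝ) ^ l - (if k = 1 then 0 else ((k:ℝ) - 1) ^ l)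

lemma hh_sum (l : ℕ) (k : ℕ) (hk : 1 ≤ k) : ∑ i ∈ Finset.Icc 1 k, hh l i = (k:ℝ) ^ l := by
  induction k, hk using Nat.le_induction with
  | base => simp [hh]
  | succ n hn ih =>
    rw [Finset.sum_Icc_succ_top (by omega), ih]
    have : n ≠ 0 := by omega
    simp [hh, this]

lemma hh_one (l : ℕ) : hh l 1 = 1 := by simp [hh]

lemma hh_bd (l k : ℕ) : 0 ≤ hh l k ∧ hh l k ≤ (k:ℝ) ^ l := by
  unfold hh
  split_ifs with h1 h2
  · simp
  · simp
  · have : (1:ℝ) ≤ k := by exact_mod_cast (by omega : 1 ≤ k)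
    have h3 : ((k:ℝ) - 1) ^ l ≤ (k:ℝ) ^ l := by gcongr; linarith
    have h4 : 0 ≤ ((k:ℝ) - 1) ^ l := by apply pow_nonneg; linarith
    constructor <;> linarith

open Classical in
noncomputable def ww (l : ℕ) : ArithmeticFunction ℝ :=
  ⟨fun n => if IsPrimePow n then hh l (n.factorization n.minFac) else 0, by simp [not_isPrimePow_zero]⟩

lemma ww_pow (l : ℕ) {p : ℕ} (hp : p.Prime) {k : ℕ} (hk : k ≠ 0) : ww l (p ^ k) = hh l k := by
  have h1 : IsPrimePow (p ^ k) := hp.isPrimePow.pow hk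
  simp only [ww, ArithmeticFunction.coe_mk, if_pos h1, hp.pow_minFac hk]
  simp [hp.factorization_self]

lemma ww_not (l : ℕ) {n : ℕ} (h : ¬ IsPrimePow n) : ww l n = 0 := by
  simp [ww, h]

lemma kap_pow {p : ℕ} (hp : p.Prime) {k : ℕ} (hk : k ≠ 0) : kap (p ^ k) = 1 / (k:ℝ) := by
  unfold kap
  rw [ArithmeticFunction.vonMangoldt_apply_pow hk, ArithmeticFunction.vonMangoldt_apply_prime hp]
  push_cast
  rw [Real.log_pow]
  have : 0 < Real.log p := Real.log_pos (by exact_mod_cast hp.one_lt)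
  have : (k:ℝ) ≠ 0 := by exact_mod_cast hk
  field_simp

lemma kap_not {n : ℕ} (h : ¬ IsPrimePow n) : kap n = 0 := by
  unfold kap
  rw [ArithmeticFunction.vonMangoldt_eq_zero_iff.2 h]; simp

lemma ww_sum (l : ℕ) {n : ℕ} (hn : n ≠ 0) :
    ∑ p ∈ n.primeFactors, ((n.factorization p : ℝ)) ^ l = ∑ d ∈ n.divisors, ww l d := by
  have e1 : ∑ p ∈ n.primeFactors, ((n.factorization p : ℝ)) ^ l
      = ∑ p ∈ n.primeFactors, ∑ i ∈ Finset.Icc 1 (n.factorization p), ww l (p ^ i) := by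
    refine Finset.sum_congr rfl (fun p hp => ?_)
    have hpp := Nat.prime_of_mem_primeFactors hp
    have h1 : 1 ≤ n.factorization p := (hpp.factorization_pos_of_dvd hn (Nat.dvd_of_mem_primeFactors hp))
    rw [← hh_sum l _ h1]
    refine Finset.sum_congr rfl (fun i hi => ?_)
    rw [Finset.mem_Icc] at hi
    rw [ww_pow l hpp (by omega)]
  classical
  have e2 : ∑ d ∈ n.divisors, ww l d = ∑ d ∈ n.divisors.filter IsPrimePow, ww l d := by
    rw [Finset.sum_filter_of_ne]
    intro d _ hd
    by_contra h
    exact hd (ww_not l h)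
  rw [e1, e2, Finset.sum_sigma']
  refine Finset.sum_bij (fun a _ => a.1 ^ a.2) ?_ ?_ ?_ ?_
  · rintro ⟨p, i⟩ ha
    simp only [Finset.mem_sigma, Finset.mem_Icc] at ha
    have hpp := Nat.prime_of_mem_primeFactors ha.1
    simp only [Finset.mem_filter, Nat.mem_divisors]
    refine ⟨⟨(hpp.pow_dvd_iff_le_factorization hn).2 ha.2.2, hn⟩, hpp.isPrimePow.pow (by omega)⟩
  · rintro ⟨p, i⟩ ha ⟨q, j⟩ hb hab
    simp only [Finset.mem_sigma, Finset.mem_Icc] at ha hb hab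
    have hpp := Nat.prime_of_mem_primeFactors ha.1
    have hqq := Nat.prime_of_mem_primeFactors hb.1
    have h1 : p = q := by
      rw [← hpp.pow_minFac (k := i) (by omega), hab, hqq.pow_minFac (by omega)]
    subst h1
    have h2 : i = j := Nat.pow_right_injective hpp.two_le hab
    subst h2
    rfl
  · intro d hd
    simp only [Finset.mem_filter, Nat.mem_divisors] at hd
    obtain ⟨⟨hdn, _⟩, hpw⟩ := hd
    obtain ⟨p, k, hp, hk, rfl⟩ := (isPrimePow_nat_iff _).1 hpw
    refine ⟨⟨p, k⟩, ?_, rfl⟩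
    simp only [Finset.mem_sigma, Finset.mem_Icc]
    refine ⟨?_, by omega, (hp.pow_dvd_iff_le_factorization hn).1 hdn⟩
    rw [Nat.mem_primeFactors]
    exact ⟨hp, (dvd_pow_self p (by omega)).trans hdn, hn⟩
  · intro a ha; rfl

noncomputable def ee (l n : ℕ) : ℝ := ww l n - kap n

lemma S_eq (l : ℕ) (x : ℝ) :
    (∑ n ∈ Finset.Icc 1 ⌊x⌋₊, ∑ p ∈ n.primeFactors, ((n.factorization p : ℝ)) ^ l)
      = TT x + ∑ n ∈ Finset.Icc 1 ⌊x⌋₊, ee l n * (⌊x / n⌋₊ : ℝ) := by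
  have hI : Finset.Icc 1 ⌊x⌋₊ = Finset.Ioc 0 ⌊x⌋₊ := rfl
  have e1 : (∑ n ∈ Finset.Icc 1 ⌊x⌋₊, ∑ p ∈ n.primeFactors, ((n.factorization p : ℝ)) ^ l)
      = ∑ n ∈ Finset.Icc 1 ⌊x⌋₊, ww l n * (⌊x / n⌋₊ : ℝ) := by
    rw [hI]
    simp_rw [Nat.floor_div_natCast]
    rw [← ArithmeticFunction.sum_Ioc_mul_zeta_eq_sum]
    refine Finset.sum_congr rfl (fun n hn => ?_)
    rw [Finset.mem_Ioc] at hn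
    rw [ArithmeticFunction.coe_mul_zeta_apply, ww_sum l (by omega)]
  rw [e1, TT, ← Finset.sum_add_distrib]
  refine Finset.sum_congr rfl (fun n hn => ?_)
  unfold ee; ring

lemma ee_not (l : ℕ) {n : ℕ} (h : ¬ IsPrimePow n) : ee l n = 0 := by
  rw [ee, ww_not l h, kap_not h, sub_zero]

lemma ee_pow (l : ℕ) {p : ℕ} (hp : p.Prime) (k : ℕ) : ee l (p ^ (k+1)) = hh l (k+1) - 1 / ((k:ℝ)+1) := by
  rw [ee, ww_pow l hp (by omega), kap_pow hp (by omega)]; push_cast; rfl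

lemma ee_pow_bd (l : ℕ) {p : ℕ} (hp : p.Prime) (k : ℕ) : |ee l (p ^ (k+1))| ≤ (if k = 0 then 0 else ((k:ℝ)+1) ^ l) := by
  rw [ee_pow l hp]
  split_ifs with h
  · subst h; simp [hh_one]
  · obtain ⟨h1, h2⟩ := hh_bd l (k+1)
    push_cast at h2
    have hk : (0:ℝ) ≤ k := by positivity
    have h3 : 1 / ((k:ℝ)+1) ≤ 1 := by rw [div_le_one (by linarith)]; linarith
    have h4 : 0 ≤ 1 / ((k:ℝ)+1) := by positivity
    have h5 : 1 ≤ ((k:ℝ)+1) ^ l := one_le_pow₀ (by linarith)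
    rw [abs_le]; constructor <;> linarith

lemma ee_summable (l : ℕ) : Summable (fun n : ℕ => |ee l n| * (n:ℝ) ^ (-(3/4:ℝ))) := by
  have hsupp : Function.support (fun n : ℕ => |ee l n| * (n:ℝ) ^ (-(3/4:ℝ))) ⊆ {n | IsPrimePow n} := by
    intro n hn
    by_contra h
    apply hn
    simp only
    rw [ee_not l h]; simp
  rw [← Set.indicator_eq_self.2 hsupp, ← summable_subtype_iff_indicator]
  refine (Nat.Primes.prodNatEquiv.summable_iff (f := (fun n : ℕ => |ee l n| * (n:ℝ) ^ (-(3/4:ℝ))) ∘ Subtype.val)).1 ?_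
  set r : ℝ := 2 ^ (-(3/4:ℝ)) with hr
  have hr0 : 0 < r := by positivity
  have hr1 : r < 1 := by rw [hr]; apply Real.rpow_lt_one_of_one_lt_of_neg <;> norm_num
  have hs1 : Summable (fun p : Nat.Primes => ((p:ℕ):ℝ) ^ (-(3/2:ℝ))) := Nat.Primes.summable_rpow.2 (by norm_num)
  have hs2 : Summable (fun k : ℕ => r⁻¹ * (r⁻¹ * (((k+1 : ℕ):ℝ) ^ l * r ^ (k+1)))) := by
    apply Summable.mul_left
    apply Summable.mul_left
    exact (summable_nat_add_iff 1).2 (summable_pow_mul_geometric_of_norm_lt_one l (r := r) (by rw [Real.norm_eq_abs, abs_of_pos hr0]; exact hr1))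
  have hs := hs1.mul_of_nonneg hs2 (fun p => by positivity) (fun k => by positivity)
  refine Summable.of_nonneg_of_le (fun a => by simp only [Function.comp]; positivity) ?_ hs
  rintro ⟨p, k⟩
  simp only [Function.comp, Nat.Primes.prodNatEquiv_apply]
  have hp := p.2
  have hp2 : (2:ℝ) ≤ ((p:ℕ):ℝ) := by exact_mod_cast hp.two_le
  have hp0 : (0:ℝ) < ((p:ℕ):ℝ) := by linarith
  have hb := ee_pow_bd l hp k
  rcases Nat.eq_zero_or_pos k with h | h
  · rw [if_pos h] at hb
    have h0 : |ee l ((p:ℕ) ^ (k+1))| = 0 := le_antisymm hb (abs_nonneg _)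
    rw [h0, zero_mul]; positivity
  · rw [if_neg (by omega)] at hb
    obtain ⟨m, rfl⟩ : ∃ m, k = m + 1 := ⟨k - 1, by omega⟩
    have hq : (((p:ℕ) ^ (m+1+1) : ℕ) : ℝ) ^ (-(3/4:ℝ)) = ((p:ℕ):ℝ) ^ (-(3/2:ℝ)) * (((p:ℕ):ℝ) ^ (-(3/4:ℝ))) ^ m := by
      push_cast
      rw [← Real.rpow_natCast, ← Real.rpow_natCast, ← Real.rpow_mul hp0.le, ← Real.rpow_mul hp0.le, ← Real.rpow_add hp0]
      congr 1
      push_cast; ring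
    have hpr : ((p:ℕ):ℝ) ^ (-(3/4:ℝ)) ≤ r := Real.rpow_le_rpow_of_nonpos (by norm_num) hp2 (by norm_num)
    rw [hq]
    calc |ee l ((p:ℕ) ^ (m+1+1))| * (((p:ℕ):ℝ) ^ (-(3/2:ℝ)) * (((p:ℕ):ℝ) ^ (-(3/4:ℝ))) ^ m)
        ≤ (((m+1:ℕ):ℝ) + 1) ^ l * (((p:ℕ):ℝ) ^ (-(3/2:ℝ)) * r ^ m) := by gcongr
      _ = _ := by push_cast; field_simp; ring

lemma ee_zero (l : ℕ) : ee l 0 = 0 := ee_not l not_isPrimePow_zero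

lemma ee_div_summable (l : ℕ) : Summable (fun n : ℕ => |ee l n / n|) := by
  refine Summable.of_nonneg_of_le (fun n => abs_nonneg _) ?_ (ee_summable l)
  intro n
  rcases Nat.eq_zero_or_pos n with h | h
  · subst h; simp [ee_zero]
  · have hn : (1:ℝ) ≤ n := by exact_mod_cast h
    rw [abs_div, abs_of_pos (by linarith : (0:ℝ) < n), div_eq_mul_inv, ← Real.rpow_neg_one]
    gcongr
    norm_num

lemma ee_asymp (l : ℕ) : ∃ C > 0, ∀ x : ℝ, 1 ≤ x →
    |∑ n ∈ Finset.Icc 1 ⌊x⌋₊, ee l n * (⌊x / n⌋₊ : ℝ) - x * ∑' n : ℕ, ee l n / n| ≤ C * x ^ (3/4:ℝ) := by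
  have hS := ee_summable l
  refine ⟨(∑' n : ℕ, |ee l n| * (n:ℝ) ^ (-(3/4:ℝ))) + 1, ?_, fun x hx => ?_⟩
  · have : 0 ≤ ∑' n : ℕ, |ee l n| * (n:ℝ) ^ (-(3/4:ℝ)) := tsum_nonneg (fun n => by positivity)
    linarith
  have hx0 : 0 < x := by linarith
  have hD : Summable (fun n : ℕ => ee l n / n) := (ee_div_summable l).of_abs
  have hfin : ∑ n ∈ Finset.Icc 1 ⌊x⌋₊, ee l n * (⌊x / n⌋₊ : ℝ) = ∑' n : ℕ, ee l n * (⌊x / n⌋₊ : ℝ) := by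
    symm
    apply tsum_eq_sum
    intro n hn
    rcases Nat.eq_zero_or_pos n with h | h
    · subst h; simp [ee_zero]
    · have : ⌊x⌋₊ < n := by
        simp only [Finset.mem_Icc, not_and, not_le] at hn; exact hn h
      rw [Nat.floor_div_natCast, Nat.div_eq_of_lt this]; simp
  have hfs : Summable (fun n : ℕ => ee l n * (⌊x / n⌋₊ : ℝ)) := by
    apply summable_of_ne_finset_zero (s := Finset.Icc 1 ⌊x⌋₊)
    intro n hn
    rcases Nat.eq_zero_or_pos n with h | h
    · subst h; simp [ee_zero]
    · have : ⌊x⌋₊ < n := by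
        simp only [Finset.mem_Icc, not_and, not_le] at hn; exact hn h
      rw [Nat.floor_div_natCast, Nat.div_eq_of_lt this]; simp
  rw [hfin, ← tsum_mul_left, ← (hfs.tsum_sub (hD.mul_left x))]
  have hbd : ∀ n : ℕ, ‖ee l n * (⌊x / n⌋₊ : ℝ) - x * (ee l n / n)‖ ≤ x ^ (3/4:ℝ) * (|ee l n| * (n:ℝ) ^ (-(3/4:ℝ))) := by
    intro n
    rcases Nat.eq_zero_or_pos n with h | h
    · subst h; simp [ee_zero]
    · have hn : (0:ℝ) < n := by exact_mod_cast h
      set y := x / n with hy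
      have hy0 : 0 < y := by positivity
      have e : ee l n * (⌊y⌋₊ : ℝ) - x * (ee l n / n) = ee l n * ((⌊y⌋₊ : ℝ) - y) := by rw [hy]; ring
      have e2 : x ^ (3/4:ℝ) * (|ee l n| * (n:ℝ) ^ (-(3/4:ℝ))) = |ee l n| * y ^ (3/4:ℝ) := by
        rw [hy, Real.div_rpow hx0.le hn.le, Real.rpow_neg hn.le]; ring
      rw [e, e2, Real.norm_eq_abs, abs_mul]
      gcongr
      have f1 := Nat.floor_le hy0.le
      have f2 := Nat.lt_floor_add_one y
      have f3 : (0:ℝ) ≤ (⌊y⌋₊ : ℝ) := by positivity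
      rw [abs_sub_comm, abs_of_nonneg (by linarith)]
      rcases le_or_gt 1 y with h1 | h1
      · have := Real.one_le_rpow h1 (by norm_num : (0:ℝ) ≤ 3/4)
        linarith
      · have := Real.rpow_le_rpow_of_exponent_ge hy0 h1.le (by norm_num : (3/4:ℝ) ≤ 1)
        rw [Real.rpow_one] at this
        linarith
  have := tsum_of_norm_bounded (hS.mul_left (x ^ (3/4:ℝ))).hasSum hbd
  rw [Real.norm_eq_abs, tsum_mul_left] at this
  refine this.trans ?_
  have : 0 < x ^ (3/4:ℝ) := by positivity
  nlinarith

lemma prime_term (l : ℕ) {p : ℕ} (hp : p.Prime) :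
    Real.log (1 - 1 / (p : ℝ)) + (1 - 1 / (p : ℝ)) * ∑' ν : ℕ, ((ν : ℝ) + 1) ^ l / (p : ℝ) ^ (ν + 1)
      = ∑' k : ℕ, ee l (p ^ (k+1)) / ((p ^ (k+1) : ℕ) : ℝ) := by
  have hp2 : (2:ℝ) ≤ (p:ℝ) := by exact_mod_cast hp.two_le
  set y : ℝ := 1 / (p:ℝ) with hy
  have hy0 : 0 < y := by positivity
  have hy1 : y < 1 := by rw [hy, div_lt_one (by linarith)]; linarith
  have hlog := Real.hasSum_pow_div_log_of_abs_lt_one (x := y) (by rw [abs_of_pos hy0]; exact hy1)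
  have e0 : ∀ k : ℕ, ((k:ℝ)+1) ^ l / (p:ℝ) ^ (k+1) = ((k+1:ℕ):ℝ) ^ l * y ^ (k+1) := by
    intro k; rw [hy, div_pow, one_pow]; push_cast; ring
  simp_rw [e0]
  have hg : Summable (fun k : ℕ => ((k+1:ℕ):ℝ) ^ l * y ^ (k+1)) :=
    (summable_nat_add_iff (f := fun k : ℕ => ((k:ℕ):ℝ) ^ l * y ^ k) 1).2 (summable_pow_mul_geometric_of_norm_lt_one l (r := y) (by rw [Real.norm_eq_abs, abs_of_pos hy0]; exact hy1))
  set G := ∑' k : ℕ, ((k+1:ℕ):ℝ) ^ l * y ^ (k+1) with hG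
  set b : ℕ → ℝ := fun k => if k = 0 then 0 else (k:ℝ) ^ l * y ^ (k+1) with hb
  have hb1 : HasSum (fun k => b (k+1)) (y * G) := by
    have := (hg.hasSum).mul_left y
    have e : (fun k => b (k+1)) = fun k : ℕ => y * (((k+1:ℕ):ℝ) ^ l * y ^ (k+1)) := by
      funext k
      simp only [hb, if_neg (Nat.succ_ne_zero k)]
      ring
    rw [e]; exact this
  have hb2 : HasSum b (y * G) := by
    have := (hasSum_nat_add_iff (f := b) 1).1 hb1
    simpa [hb] using this
  have hmain := (hg.hasSum.sub hb2).sub hlog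
  have hfin : HasSum (fun k : ℕ => ee l (p ^ (k+1)) / ((p ^ (k+1) : ℕ) : ℝ)) (G - y * G - -Real.log (1 - y)) 
      := by
    suffices e : (fun k : ℕ => ee l (p ^ (k+1)) / ((p ^ (k+1) : ℕ) : ℝ)) = fun k : ℕ => ((k+1:ℕ):ℝ) ^ l * y ^ (k+1) - b k - y ^ (k+1) / ((k:ℝ)+1) by
      rw [e]; exact hmain
    funext k
    rw [ee_pow l hp, hh, if_neg (by omega), hb]
    push_cast
    have : (p:ℝ) ^ (k+1) = (y ^ (k+1))⁻¹ := by rw [hy]; simp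
    rw [this, div_inv_eq_mul]
    rcases Nat.eq_zero_or_pos k with h | h
    · subst h; simp
    · simp only [show k + 1 ≠ 1 by omega, show k ≠ 0 by omega, if_false]
      ring
  rw [hfin.tsum_eq]; ring

lemma prime_summable (l : ℕ) : Summable (fun p : Nat.Primes =>
    |∑' k : ℕ, ee l ((p:ℕ) ^ (k+1)) / (((p:ℕ) ^ (k+1) : ℕ) : ℝ)|) := by
  have h1 := ee_div_summable l
  have h2 := (h1.comp_injective Subtype.val_injective).comp_injective Nat.Primes.prodNatEquiv.injective
  have h3 := h2.prod
  refine Summable.of_nonneg_of_le (fun p => abs_nonneg _) ?_ h3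
  intro p
  have h4 := h2.prod_factor p
  have := norm_tsum_le_tsum_norm (f := fun k : ℕ => ee l ((p:ℕ) ^ (k+1)) / (((p:ℕ) ^ (k+1) : ℕ) : ℝ)) h4
  exact this

lemma prime_tsum (l : ℕ) : ∑' n : ℕ, ee l n / n = ∑' p : Nat.Primes, ∑' k : ℕ, ee l ((p:ℕ) ^ (k+1)) / (((p:ℕ) ^ (k+1) : ℕ) : ℝ) := by
  apply tsum_eq_tsum_primes_of_support_subset_prime_powers (f := fun n : ℕ => ee l n / n) (ee_div_summable l).of_abs
  intro n hn
  by_contra h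
  apply hn
  simp only
  rw [ee_not l h]; simp

theorem final (l : ℕ) (N : ℕ) (hN : 1 ≤ N) :
    Summable (fun p : Nat.Primes =>
      |Real.log (1 - 1 / ((p : ℕ) : ℝ)) +
        (1 - 1 / ((p : ℕ) : ℝ)) *
          ∑' ν : ℕ, ((ν : ℝ) + 1) ^ l / ((p : ℕ) : ℝ) ^ (ν + 1)|) ∧
    ∃ c > (0 : ℝ), ∃ x₀ : ℝ, 3 ≤ x₀ ∧ ∀ x ≥ x₀,
      |(∑ n ∈ Finset.Icc 1 ⌊x⌋₊, ∑ p ∈ n.primeFactors, ((n.factorization p : ℝ)) ^ l) -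
        (x * Real.log (Real.log x) +
          (Real.eulerMascheroniConstant +
            ∑' p : Nat.Primes,
              (Real.log (1 - 1 / ((p : ℕ) : ℝ)) +
                (1 - 1 / ((p : ℕ) : ℝ)) *
                  ∑' ν : ℕ, ((ν : ℝ) + 1) ^ l / ((p : ℕ) : ℝ) ^ (ν + 1))) * x +
          x * ∑ j ∈ Finset.Icc 1 N,
            (-∫ t in Set.Ioi (1 : ℝ),
                (t - (⌊t⌋₊ : ℝ)) * (Real.log t) ^ (j - 1) / t ^ 2) /
              (Real.log x) ^ j)| ≤
        c * x / (Real.log x) ^ (N + 1) := by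
  have ht : ∀ p : Nat.Primes, Real.log (1 - 1 / ((p : ℕ) : ℝ)) + (1 - 1 / ((p : ℕ) : ℝ)) *
      ∑' ν : ℕ, ((ν : ℝ) + 1) ^ l / ((p : ℕ) : ℝ) ^ (ν + 1) = ∑' k : ℕ, ee l ((p:ℕ) ^ (k+1)) / (((p:ℕ) ^ (k+1) : ℕ) : ℝ) :=
    fun p => prime_term l p.2
  simp_rw [ht]
  refine ⟨prime_summable l, ?_⟩
  rw [← prime_tsum]
  obtain ⟨C1, hC1, h1⟩ := TT_asymp N
  obtain ⟨C2, hC2, h2⟩ := ee_asymp l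
  obtain ⟨C3, hC3, h3⟩ := log_pow_le (N+1)
  refine ⟨C1 + C2 * (C3 * 2 ^ (N+1)), by positivity, 16, by norm_num, fun x hx => ?_⟩
  have hx0 : 0 < x := by linarith
  have a1 := h1 x hx
  have a2 := h2 x (by linarith)
  have hL0 : 0 < Real.log x := Real.log_pos (by linarith)
  have a3 : x ^ (3/4:ℝ) ≤ C3 * 2 ^ (N+1) * (x / Real.log x ^ (N+1)) := by
    have b := h3 (√x) (by apply Real.le_sqrt_of_sq_le; linarith)
    rw [Real.log_sqrt hx0.le, div_pow, div_le_iff₀ (by positivity)] at b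
    rw [← mul_div_assoc, le_div_iff₀ (by positivity)]
    have e1 : √(√x) = x ^ (1/4:ℝ) := by
      rw [Real.sqrt_eq_rpow, Real.sqrt_eq_rpow, ← Real.rpow_mul hx0.le]; norm_num
    rw [e1] at b
    have e2 : x ^ (3/4:ℝ) * x ^ (1/4:ℝ) = x := by
      rw [← Real.rpow_add hx0]; norm_num
    calc x ^ (3/4:ℝ) * Real.log x ^ (N+1) ≤ x ^ (3/4:ℝ) * (C3 * x ^ (1/4:ℝ) * 2 ^ (N+1)) := by gcongr
      _ = C3 * 2 ^ (N+1) * (x ^ (3/4:ℝ) * x ^ (1/4:ℝ)) := by ring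
      _ = _ := by rw [e2]
  have a4 : C2 * x ^ (3/4:ℝ) ≤ C2 * (C3 * 2 ^ (N+1) * (x / Real.log x ^ (N+1))) := by gcongr
  rw [S_eq]
  have hS : ∑ j ∈ Finset.Icc 1 N, (-∫ t in Set.Ioi (1 : ℝ), (t - (⌊t⌋₊ : ℝ)) * (Real.log t) ^ (j - 1) / t ^ 2) / (Real.log x) ^ j
      = - ∑ j ∈ Finset.Icc 1 N, (∫ t in Set.Ioi 1, gg (j-1) t) / Real.log x ^ j := by
    rw [← Finset.sum_neg_distrib]
    refine Finset.sum_congr rfl (fun j _ => ?_)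
    rw [neg_div]; rfl
  rw [hS]
  have e9 : (C1 + C2 * (C3 * 2 ^ (N+1))) * x / Real.log x ^ (N+1) = C1 * (x / Real.log x ^ (N+1)) + C2 * (C3 * 2 ^ (N+1) * (x / Real.log x ^ (N+1))) := by ring
  rw [e9]
  rw [abs_le] at *
  constructor <;> linarith [a1.1, a1.2, a2.1, a2.2]
end Stmt9



/-- **Mean value of the generalized omega function** `Ω_ℓ(n) = Σ_{p^ν ∥ n} ν^ℓ`
(Corollary `Cor_Omega_ell`; here `ν = n.factorization p`). For every fixed `N ≥ 1`:
`Σ_{n ≤ x} Ω_ℓ(n) = x log log x + C x + x Σ_{j=1}^N a_j/(log x)^j + O(x/(log x)^{N+1})`,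
with `C = γ + Σ_p (log(1 − 1/p) + (1 − 1/p) Σ_{ν ≥ 1} ν^ℓ/p^ν)` (absolutely
convergent sum over primes) and `a_j = −∫_1^∞ (t − ⌊t⌋)(log t)^{j−1}/t² dt`. -/
theorem stmt_9 (l : ℕ) (N : ℕ) (hN : 1 ≤ N) :
    Summable (fun p : Nat.Primes =>
      |Real.log (1 - 1 / ((p : ℕ) : ℝ)) +
        (1 - 1 / ((p : ℕ) : ℝ)) *
          ∑' ν : ℕ, ((ν : ℝ) + 1) ^ l / ((p : ℕ) : ℝ) ^ (ν + 1)|) ∧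
    ∃ c > (0 : ℝ), ∃ x₀ : ℝ, 3 ≤ x₀ ∧ ∀ x ≥ x₀,
      |(∑ n ∈ Finset.Icc 1 ⌊x⌋₊, ∑ p ∈ n.primeFactors, ((n.factorization p : ℝ)) ^ l) -
        (x * Real.log (Real.log x) +
          (Real.eulerMascheroniConstant +
            ∑' p : Nat.Primes,
              (Real.log (1 - 1 / ((p : ℕ) : ℝ)) +
                (1 - 1 / ((p : ℕ) : ℝ)) *
                  ∑' ν : ℕ, ((ν : ℝ) + 1) ^ l / ((p : ℕ) : ℝ) ^ (ν + 1))) * x +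
          x * ∑ j ∈ Finset.Icc 1 N,
            (-∫ t in Set.Ioi (1 : ℝ),
                (t - (⌊t⌋₊ : ℝ)) * (Real.log t) ^ (j - 1) / t ^ 2) /
              (Real.log x) ^ j)| ≤
        c * x / (Real.log x) ^ (N + 1) := by
  exact Stmt9.final l N hN
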